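/- arXiv:1412.4627 — 2 statements merged into one kernel-verified Lean document; each statement's English description precedes it below -/
import Mathlib

section
/- Let A (n×n) and B (m×m) be non-degenerate linking matrices, (H, φ) a finite linked group, γ an A-presentation of H and η a B-presentation of H, and U ∈ M_{n,m}(ℤ), V ∈ M_{m,n}(ℤ) integer matrices with γᵢ = Σⱼ Uᵢⱼ ηⱼ and ηᵢ = Σⱼ Vᵢⱼ γⱼ in H for all i. Equip V₁ = ℚⁿ with ψ_A(x, y) = xᵀAy and V₂ = ℚᵐ with ψ_B(x, y) = xᵀBy, set R₁ = ℤⁿ, R₂ = ℤᵐ, gᵢ = A⁻¹eᵢ and hⱼ = B⁻¹εⱼ (the columns of A⁻¹ and B⁻¹). Let f : V₁ → V₂ be the ℚ-linear map determined by f(gᵢ) = Σⱼ Uᵢⱼ hⱼ. Then f(R₁♯) ⊆ R₂♯ and f(R₁) ⊆ R₂, the induced homomorphism f̄ : R₁♯/R₁ → R₂♯/R₂ is bijective, and ψ_B(f(x), f(y)) − ψ_A(x, y) ∈ ℤ for all x, y ∈ R₁♯. -/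
open Matrix

noncomputable section

/-- The group `ℚ/ℤ`. -/
abbrev QZ : Type := AddCircle (1 : ℚ)

/-- The rational matrix obtained from an integer matrix. -/
def mQ {k l : ℕ} (M : Matrix (Fin k) (Fin l) ℤ) : Matrix (Fin k) (Fin l) ℚ :=
  M.map (fun a => (a : ℚ))

/-- `ψ_M(x, y) = xᵀ M y`, the bilinear form on `ℚᵏ` associated with an integer matrix `M`. -/
def psi {k : ℕ} (M : Matrix (Fin k) (Fin k) ℤ) (x y : Fin k → ℚ) : ℚ :=
  x ⬝ᵥ (mQ M *ᵥ y)

/-- A rational number is an integer. -/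
def IsIntQ (q : ℚ) : Prop := ∃ a : ℤ, q = a

/-- A rational vector has integer entries, i.e. belongs to the lattice `ℤᵏ ⊂ ℚᵏ`. -/
def IsIntVec {k : ℕ} (x : Fin k → ℚ) : Prop := ∀ i, IsIntQ (x i)

/-- `x` belongs to the dual lattice of `ℤᵏ` with respect to `ψ_M`. -/
def InDual {k : ℕ} (M : Matrix (Fin k) (Fin k) ℤ) (x : Fin k → ℚ) : Prop :=
  ∀ y, IsIntVec y → IsIntQ (psi M x y)

/-- An `A`-presentation of a (finite) linked group `(H, φ)` for a non-degenerate
linking matrix `A`. -/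
def IsPresentation {k : ℕ} {H : Type} [AddCommGroup H]
    (φ : H → H → QZ) (A : Matrix (Fin k) (Fin k) ℤ) (η : Fin k → H) : Prop :=
  (Function.Surjective fun v : Fin k → ℤ => ∑ i, v i • η i) ∧
  (∀ v : Fin k → ℤ, (∑ i, v i • η i) = 0 ↔ ∃ w, v = A *ᵥ w) ∧
  (∀ i j, φ (η i) (η j) = (((mQ A)⁻¹ i j : ℚ) : QZ))

def cV {k : ℕ} (c : Fin k → ℤ) : Fin k → ℚ := fun i => (c i : ℚ)

theorem cV_inj {k : ℕ} {c d : Fin k → ℤ} (h : cV c = cV d) : c = d := by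
  funext i
  have := congrFun h i
  simpa [cV] using this

theorem cV_mul {k l : ℕ} (M : Matrix (Fin k) (Fin l) ℤ) (w : Fin l → ℤ) :
    cV (M *ᵥ w) = mQ M *ᵥ cV w := by
  funext i
  simp [cV, mQ, Matrix.mulVec, dotProduct]

theorem isIntVec_cV {k : ℕ} (c : Fin k → ℤ) : IsIntVec (cV c) := fun i => ⟨c i, rfl⟩

theorem exists_cV {k : ℕ} {x : Fin k → ℚ} (h : IsIntVec x) : ∃ c, x = cV c := by
  choose c hc using h
  exact ⟨c, funext hc⟩

theorem mQ_symm {k : ℕ} {M : Matrix (Fin k) (Fin k) ℤ} (hM : M.IsSymm) : (mQ M)ᵀ = mQ M := by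
  ext i j
  simp [mQ, hM.apply i j]

theorem mQ_unit {k : ℕ} {M : Matrix (Fin k) (Fin k) ℤ} (hM : M.det ≠ 0) : IsUnit (mQ M).det := by
  have : (mQ M).det = ((M.det : ℤ) : ℚ) := by
    have := (Int.castRingHom ℚ).map_det M
    simpa [mQ, RingHom.mapMatrix_apply] using this.symm
  rw [this]
  exact isUnit_iff_ne_zero.mpr (by exact_mod_cast hM)

theorem mQ_inj {k : ℕ} {M : Matrix (Fin k) (Fin k) ℤ} (hM : M.det ≠ 0) {x y : Fin k → ℚ}
    (h : mQ M *ᵥ x = mQ M *ᵥ y) : x = y := by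
  have := congrArg (fun v => (mQ M)⁻¹ *ᵥ v) h
  simpa [Matrix.mulVec_mulVec, Matrix.nonsing_inv_mul _ (mQ_unit hM)] using this

theorem psi_symm {k : ℕ} {M : Matrix (Fin k) (Fin k) ℤ} (hM : M.IsSymm) (x y : Fin k → ℚ) :
    psi M x y = (mQ M *ᵥ x) ⬝ᵥ y := by
  unfold psi
  rw [Matrix.dotProduct_mulVec, ← Matrix.mulVec_transpose, mQ_symm hM]

theorem inDual_iff {k : ℕ} {M : Matrix (Fin k) (Fin k) ℤ} (hM : M.IsSymm) (x : Fin k → ℚ) :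
    InDual M x ↔ ∃ c, mQ M *ᵥ x = cV c := by
  constructor
  · intro h
    apply exists_cV
    intro i
    have := h (Pi.single i 1) (by
      intro j
      by_cases hj : j = i
      · subst hj; exact ⟨1, by simp⟩
      · exact ⟨0, by simp [hj]⟩)
    rw [psi_symm hM] at this
    simpa using this
  · rintro ⟨c, hc⟩ y hy
    obtain ⟨d, rfl⟩ := exists_cV hy
    rw [psi_symm hM, hc]
    exact ⟨∑ i, c i * d i, by simp [cV, dotProduct]⟩

theorem psi_phi {k : ℕ} {H : Type} [AddCommGroup H] (φ : H → H → QZ)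
    (hφsymm : ∀ x y, φ x y = φ y x)
    (hφadd : ∀ x y z, φ (x + y) z = φ x z + φ y z)
    (M : Matrix (Fin k) (Fin k) ℤ) (hM : M.IsSymm) (hdet : M.det ≠ 0)
    (η : Fin k → H) (hη : IsPresentation φ M η) (x y : Fin k → ℚ) (c d : Fin k → ℤ)
    (hc : mQ M *ᵥ x = cV c) (hd : mQ M *ᵥ y = cV d) :
    ((psi M x y : ℚ) : QZ) = φ (∑ i, c i • η i) (∑ i, d i • η i) := by
  have hx : x = (mQ M)⁻¹ *ᵥ cV c := by
    rw [← hc, Matrix.mulVec_mulVec, Matrix.nonsing_inv_mul _ (mQ_unit hdet), Matrix.one_mulVec]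
  let F : H → H →+ QZ := fun z => AddMonoidHom.mk' (fun x => φ x z) (fun a b => hφadd a b z)
  have hF : ∀ (c : Fin k → ℤ) z, φ (∑ i, c i • η i) z = ∑ i, c i • φ (η i) z := by
    intro c z
    have := map_sum (F z) (fun i => c i • η i) Finset.univ
    simp only [map_zsmul] at this
    exact this
  rw [hF]
  simp_rw [hφsymm _ (∑ i, d i • η i), hF, hη.2.2]
  have h1 : psi M x y = ∑ i, c i • ∑ j, d j • (mQ M)⁻¹ j i := by
    unfold psi
    rw [hd, hx]
    simp only [dotProduct, Matrix.mulVec, cV, zsmul_eq_mul, Finset.sum_mul, Finset.mul_sum]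
    rw [Finset.sum_comm]
    refine Finset.sum_congr rfl fun i _ => Finset.sum_congr rfl fun j _ => by ring
  rw [h1]
  let q : ℚ →+ QZ := QuotientAddGroup.mk' (AddSubgroup.zmultiples (1 : ℚ))
  change q (∑ i, c i • ∑ j, d j • (mQ M)⁻¹ j i) = ∑ i, c i • ∑ j, d j • q ((mQ M)⁻¹ j i)
  rw [map_sum]
  refine Finset.sum_congr rfl fun i _ => ?_
  rw [map_zsmul, map_sum]
  refine congrArg _ (Finset.sum_congr rfl fun j _ => ?_)
  rw [map_zsmul]

/-- with `γ` an `A`-presentation and `η` a `B`-presentation of `(H, φ)`,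
and integer matrices `U`, `V` expressing each family of generators in terms of the
other, the `ℚ`-linear map `f` determined by `f(gᵢ) = Σⱼ U i j • hⱼ` (where `gᵢ`, `hⱼ`
are the columns of `A⁻¹`, `B⁻¹`) satisfies `f(R₁♯) ⊆ R₂♯`, `f(R₁) ⊆ R₂`, the induced
map `R₁♯/R₁ → R₂♯/R₂` is bijective, and `ψ_B(f x, f y) − ψ_A(x, y) ∈ ℤ` on `R₁♯`. -/
theorem f_induces_iso_of_dual_quotients {n m : ℕ} (H : Type) [AddCommGroup H] [Finite H]
    (φ : H → H → QZ)
    (hφsymm : ∀ x y, φ x y = φ y x)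
    (hφadd : ∀ x y z, φ (x + y) z = φ x z + φ y z)
    (hφadd' : ∀ x y z, φ x (y + z) = φ x y + φ x z)
    (A : Matrix (Fin n) (Fin n) ℤ) (hAsym : A.IsSymm) (hAdet : A.det ≠ 0)
    (B : Matrix (Fin m) (Fin m) ℤ) (hBsym : B.IsSymm) (hBdet : B.det ≠ 0)
    (γ : Fin n → H) (hγ : IsPresentation φ A γ)
    (η : Fin m → H) (hη : IsPresentation φ B η)
    (U : Matrix (Fin n) (Fin m) ℤ) (V : Matrix (Fin m) (Fin n) ℤ)
    (hU : ∀ i, γ i = ∑ j, U i j • η j) (hV : ∀ i, η i = ∑ j, V i j • γ j)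
    (f : (Fin n → ℚ) →ₗ[ℚ] (Fin m → ℚ))
    (hf : ∀ i, f (fun j => (mQ A)⁻¹ j i) =
      ∑ j, (U i j : ℚ) • (fun l => (mQ B)⁻¹ l j)) :
    (∀ x, InDual A x → InDual B (f x)) ∧
    (∀ x, IsIntVec x → IsIntVec (f x)) ∧
    (∀ x, InDual A x → IsIntVec (f x) → IsIntVec x) ∧
    (∀ z, InDual B z → ∃ x, InDual A x ∧ IsIntVec (z - f x)) ∧
    (∀ x y, InDual A x → InDual A y → IsIntQ (psi B (f x) (f y) - psi A x y)) := by
  have hUA : mQ A * (mQ A)⁻¹ = 1 := Matrix.mul_nonsing_inv _ (mQ_unit hAdet)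
  have hAU : (mQ A)⁻¹ * mQ A = 1 := Matrix.nonsing_inv_mul _ (mQ_unit hAdet)
  have hUB : mQ B * (mQ B)⁻¹ = 1 := Matrix.mul_nonsing_inv _ (mQ_unit hBdet)
  -- the formula for f
  have key : ∀ x c, mQ A *ᵥ x = cV c → mQ B *ᵥ f x = cV (Uᵀ *ᵥ c) := by
    intro x c hc
    have hx : x = ∑ i, (c i : ℚ) • (fun j => (mQ A)⁻¹ j i) := by
      have : x = (mQ A)⁻¹ *ᵥ cV c := by
        rw [← hc, Matrix.mulVec_mulVec, hAU, Matrix.one_mulVec]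
      rw [this]
      funext j
      simp [Matrix.mulVec, dotProduct, cV, mul_comm]
    have hfx : f x = (mQ B)⁻¹ *ᵥ cV (Uᵀ *ᵥ c) := by
      rw [hx, map_sum]
      simp only [map_smul, hf]
      funext l
      simp only [Finset.sum_apply, Pi.smul_apply, smul_eq_mul, Matrix.mulVec, dotProduct, cV,
        Matrix.transpose_apply, Int.cast_sum, Int.cast_mul, Finset.mul_sum]
      rw [Finset.sum_comm]
      refine Finset.sum_congr rfl fun i _ => Finset.sum_congr rfl fun j _ => by ring
    rw [hfx, Matrix.mulVec_mulVec, hUB, Matrix.one_mulVec]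
  have hsum : ∀ c : Fin n → ℤ, ∑ j, (Uᵀ *ᵥ c) j • η j = ∑ i, c i • γ i := by
    intro c
    simp only [hU, Matrix.mulVec, dotProduct, Matrix.transpose_apply, Finset.sum_smul,
      Finset.smul_sum, smul_smul]
    rw [Finset.sum_comm]
    refine Finset.sum_congr rfl fun i _ => Finset.sum_congr rfl fun j _ => by rw [mul_comm]
  refine ⟨?_, ?_, ?_, ?_, ?_⟩
  · intro x hx
    obtain ⟨c, hc⟩ := (inDual_iff hAsym x).1 hx
    exact (inDual_iff hBsym _).2 ⟨_, key x c hc⟩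
  · intro x hx
    obtain ⟨w, rfl⟩ := exists_cV hx
    have h0 := (hγ.2.1 (A *ᵥ w)).2 ⟨w, rfl⟩
    rw [← hsum] at h0
    obtain ⟨w', hw'⟩ := (hη.2.1 _).1 h0
    have h1 := key (cV w) (A *ᵥ w) (cV_mul A w).symm
    rw [hw', cV_mul] at h1
    rw [mQ_inj hBdet h1]
    exact isIntVec_cV w'
  · intro x hx hfx
    obtain ⟨c, hc⟩ := (inDual_iff hAsym x).1 hx
    obtain ⟨w', hw'⟩ := exists_cV hfx
    have h1 := key x c hc
    rw [hw', ← cV_mul] at h1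
    have h0 := (hη.2.1 (Uᵀ *ᵥ c)).2 ⟨w', (cV_inj h1).symm⟩
    rw [hsum] at h0
    obtain ⟨w, hw⟩ := (hγ.2.1 _).1 h0
    rw [hw, cV_mul] at hc
    rw [mQ_inj hAdet hc]
    exact isIntVec_cV w
  · intro z hz
    obtain ⟨d, hd⟩ := (inDual_iff hBsym z).1 hz
    obtain ⟨c, hc⟩ := hγ.1 (∑ j, d j • η j)
    have hx : mQ A *ᵥ ((mQ A)⁻¹ *ᵥ cV c) = cV c := by
      rw [Matrix.mulVec_mulVec, hUA, Matrix.one_mulVec]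
    refine ⟨(mQ A)⁻¹ *ᵥ cV c, (inDual_iff hAsym _).2 ⟨c, hx⟩, ?_⟩
    have h0 : ∑ j, (d - Uᵀ *ᵥ c) j • η j = 0 := by
      simp only [Pi.sub_apply, sub_smul, Finset.sum_sub_distrib]
      rw [hsum, sub_eq_zero]
      exact hc.symm
    obtain ⟨w, hw⟩ := (hη.2.1 _).1 h0
    have h1 : mQ B *ᵥ (z - f ((mQ A)⁻¹ *ᵥ cV c)) = mQ B *ᵥ cV w := by
      rw [Matrix.mulVec_sub, hd, key _ c hx, ← cV_mul, ← hw]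
      funext i
      simp [cV]
    rw [mQ_inj hBdet h1]
    exact isIntVec_cV w
  · intro x y hx hy
    obtain ⟨c, hc⟩ := (inDual_iff hAsym x).1 hx
    obtain ⟨d, hd⟩ := (inDual_iff hAsym y).1 hy
    have h1 := psi_phi φ hφsymm hφadd A hAsym hAdet γ hγ x y c d hc hd
    have h2 := psi_phi φ hφsymm hφadd B hBsym hBdet η hη (f x) (f y) _ _ (key x c hc) (key y d hd)
    rw [hsum, hsum, ← h1] at h2
    have h3 := QuotientAddGroup.eq.1 h2.symm
    obtain ⟨a, ha⟩ := AddSubgroup.mem_zmultiples_iff.1 h3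
    refine ⟨a, ?_⟩
    simp at ha
    linarith
end
end

section
/- Let (H, φ) be a linked group (a finitely generated abelian group with a linking pairing on its torsion subgroup). Let A be an admissible linking matrix of size n with an A-presentation γ = (γ₁, …, γₙ) of H, and let B be an admissible linking matrix of size m with a B-presentation η = (η₁, …, η_m) of H. Then there exist a stabilization Ã of A and a stabilization B̃ of B, of equal size N, and a unimodular N×N matrix P such that Ã = Pᵀ B̃ P and, computing in the ℤ-module H^N, P·γ' = η', where γ' = (0, …, 0, γ₁, …, γₙ) ∈ H^N and η' = (0, …, 0, η₁, …, η_m) ∈ H^N. -/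
open Matrix

noncomputable section

namespace StabCong

set_option linter.unusedSectionVars false

section basic
variable {ι κ l : Type} [Fintype ι] [Fintype κ] [Fintype l] [DecidableEq ι] [DecidableEq κ]
  [DecidableEq l]

def Cong {ι κ : Type} [Fintype ι] [Fintype κ] [DecidableEq ι] [DecidableEq κ]
    (A : Matrix ι ι ℤ) (B : Matrix κ κ ℤ) : Prop :=
  ∃ (P : Matrix κ ι ℤ) (Q : Matrix ι κ ℤ), Q * P = 1 ∧ P * Q = 1 ∧ A = Pᵀ * B * P

theorem Cong.refl (A : Matrix ι ι ℤ) : Cong A A := ⟨1, 1, by simp, by simp, by simp⟩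

theorem Cong.symm {A : Matrix ι ι ℤ} {B : Matrix κ κ ℤ} (h : Cong A B) : Cong B A := by
  obtain ⟨P, Q, h1, h2, rfl⟩ := h
  refine ⟨Q, P, h2, h1, ?_⟩
  have : Qᵀ * (Pᵀ * B * P) * Q = (P * Q)ᵀ * B * (P * Q) := by
    simp only [transpose_mul, Matrix.mul_assoc]
  rw [this, h2]; simp

theorem Cong.trans {A : Matrix ι ι ℤ} {B : Matrix κ κ ℤ} {C : Matrix l l ℤ}
    (h : Cong A B) (h' : Cong B C) : Cong A C := by
  obtain ⟨P, Q, h1, h2, rfl⟩ := h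
  obtain ⟨P', Q', h1', h2', rfl⟩ := h'
  refine ⟨P' * P, Q * Q', ?_, ?_, ?_⟩
  · rw [Matrix.mul_assoc, ← Matrix.mul_assoc Q', h1', Matrix.one_mul, h1]
  · rw [Matrix.mul_assoc, ← Matrix.mul_assoc P, h2, Matrix.one_mul, h2']
  · simp only [transpose_mul, Matrix.mul_assoc]

theorem Cong.submatrix (A : Matrix ι ι ℤ) (e : κ ≃ ι) : Cong A (A.submatrix e e) := by
  refine ⟨(1 : Matrix ι ι ℤ).submatrix e id, (1 : Matrix ι ι ℤ).submatrix id e, ?_, ?_, ?_⟩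
  · rw [Matrix.submatrix_mul_equiv]; simp
  · rw [← Matrix.submatrix_mul _ _ e id e Function.bijective_id]; simp
  · rw [Matrix.transpose_submatrix, Matrix.transpose_one, Matrix.submatrix_mul_equiv,
      Matrix.submatrix_mul_equiv]; simp

theorem Cong.of_submatrix {A : Matrix ι ι ℤ} {B : Matrix κ κ ℤ} (e : κ ≃ ι)
    (h : A.submatrix e e = B) : Cong A B := h ▸ Cong.submatrix A e

theorem Cong.card {A : Matrix ι ι ℤ} {B : Matrix κ κ ℤ} (h : Cong A B) :
    Fintype.card ι = Fintype.card κ := by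
  obtain ⟨P, Q, h1, h2, -⟩ := h
  exact Matrix.square_of_invertible Q P h1 h2

theorem Cong.absdet {A : Matrix ι ι ℤ} {B : Matrix κ κ ℤ} (h : Cong A B) :
    |A.det| = |B.det| := by
  have e := Fintype.equivOfCardEq h.card
  obtain ⟨P, Q, h1, h2, rfl⟩ := (Cong.submatrix B e).symm.trans h.symm |>.symm
  have h3 := congrArg det h1
  rw [det_mul, det_one] at h3
  have h4 : P.det * P.det = 1 := by
    rcases Int.isUnit_iff.1 (IsUnit.of_mul_eq_one_right _ h3) with h | h <;> simp [h]
  rw [det_mul, det_mul, det_transpose, mul_right_comm, h4, one_mul, det_submatrix_equiv_self]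

theorem Cong.symmetric {A : Matrix ι ι ℤ} {B : Matrix κ κ ℤ} (h : Cong A B) (hB : B.IsSymm) :
    A.IsSymm := by
  obtain ⟨P, Q, h1, h2, rfl⟩ := h
  unfold Matrix.IsSymm
  simp only [transpose_mul, Matrix.mul_assoc, transpose_transpose, hB.eq]

theorem Cong.sum {ι' κ' : Type} [Fintype ι'] [Fintype κ'] [DecidableEq ι'] [DecidableEq κ']
    {A : Matrix ι ι ℤ} {B : Matrix κ κ ℤ} {A' : Matrix ι' ι' ℤ} {B' : Matrix κ' κ' ℤ}
    (h : Cong A B) (h' : Cong A' B') :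
    Cong (fromBlocks A 0 0 A') (fromBlocks B 0 0 B') := by
  obtain ⟨P, Q, h1, h2, rfl⟩ := h
  obtain ⟨P', Q', h1', h2', rfl⟩ := h'
  refine ⟨fromBlocks P 0 0 P', fromBlocks Q 0 0 Q', ?_, ?_, ?_⟩ <;>
  simp [fromBlocks_multiply, fromBlocks_transpose, *]

/-- bordered matrix -/
def bl {ι κ : Type} (C : Matrix ι ι ℤ) (V : Matrix ι κ ℤ) (G : Matrix κ κ ℤ) :
    Matrix (ι ⊕ κ) (ι ⊕ κ) ℤ := fromBlocks C V Vᵀ G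

theorem Cong.bl_left {A : Matrix ι ι ℤ} {B : Matrix κ κ ℤ} (h : Cong A B)
    (V : Matrix ι l ℤ) (G : Matrix l l ℤ) : ∃ V', Cong (bl A V G) (bl B V' G) := by
  obtain ⟨P, Q, h1, h2, rfl⟩ := h
  refine ⟨Qᵀ * V, fromBlocks P 0 0 1, fromBlocks Q 0 0 1, ?_, ?_, ?_⟩
  · simp [fromBlocks_multiply, *]
  · simp [fromBlocks_multiply, *]
  · have h3 : Pᵀ * (Qᵀ * V) = V := by
      rw [← Matrix.mul_assoc, ← transpose_mul, h1]; simp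
    have h4 : Vᵀ * Q * P = Vᵀ := by rw [Matrix.mul_assoc, h1]; simp
    simp [bl, fromBlocks_multiply, fromBlocks_transpose, h3, h4]

theorem Cong.bl_right (C : Matrix ι ι ℤ) (V : Matrix ι κ ℤ) (G : Matrix κ κ ℤ)
    (T T' : Matrix κ κ ℤ) (h : T * T' = 1) :
    Cong (bl C V G) (bl C (V * T) (Tᵀ * G * T)) := by
  have h' : T' * T = 1 := mul_eq_one_comm.1 h
  refine Cong.symm ⟨fromBlocks 1 0 0 T, fromBlocks 1 0 0 T', ?_, ?_, ?_⟩
  · simp [fromBlocks_multiply, *]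
  · simp [fromBlocks_multiply, *]
  · simp [bl, fromBlocks_multiply, fromBlocks_transpose, Matrix.mul_assoc]

theorem bl_symm {C : Matrix ι ι ℤ} {V : Matrix ι κ ℤ} {G : Matrix κ κ ℤ} :
    (bl C V G).IsSymm ↔ C.IsSymm ∧ G.IsSymm := by
  unfold Matrix.IsSymm bl
  rw [fromBlocks_transpose, fromBlocks_inj]; simp

/-- rational version -/
def cq {m n : Type} (A : Matrix m n ℤ) : Matrix m n ℚ := A.map (Int.cast : ℤ → ℚ)

theorem cq_apply {m n : Type} (A : Matrix m n ℤ) (i : m) (j : n) : cq A i j = (A i j : ℚ) := rfl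

theorem cq_transpose {m n : Type} (A : Matrix m n ℤ) : cq Aᵀ = (cq A)ᵀ := rfl

theorem cq_inj {m n : Type} {A B : Matrix m n ℤ} (h : cq A = cq B) : A = B := by
  ext i j
  have := congrFun (congrFun h i) j
  simpa [cq_apply] using this

theorem cq_one : cq (1 : Matrix ι ι ℤ) = 1 := by
  ext i j; simp [cq_apply, Matrix.one_apply]

theorem cq_mul {m n o : Type} [Fintype n] (A : Matrix m n ℤ) (B : Matrix n o ℤ) :
    cq (A * B) = cq A * cq B := by
  ext i j; simp [cq_apply, Matrix.mul_apply]

theorem cq_add {m n : Type} (A B : Matrix m n ℤ) :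
    cq (A + B) = cq A + cq B := by
  ext i j; simp [cq_apply]

theorem cq_det (C : Matrix ι ι ℤ) : ((C.det : ℤ) : ℚ) = (cq C).det := by
  exact RingHom.map_det (Int.castRingHom ℚ) C

/-- rational Schur complement -/
def sch (C : Matrix ι ι ℤ) (V : Matrix ι κ ℤ) (G : Matrix κ κ ℤ) : Matrix κ κ ℚ :=
  cq G - (cq V)ᵀ * (cq C)⁻¹ * cq V

theorem cq_isUnit {C : Matrix ι ι ℤ} (hC : C.det ≠ 0) : IsUnit (cq C).det := by
  rw [← cq_det]; exact (Int.cast_ne_zero.2 hC).isUnit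

theorem det_bl (C : Matrix ι ι ℤ) (hC : C.det ≠ 0) (V : Matrix ι κ ℤ) (G : Matrix κ κ ℤ) :
    ((bl C V G).det : ℚ) = C.det * (sch C V G).det := by
  rw [cq_det, cq_det]
  have := Matrix.invertibleOfIsUnitDet _ (cq_isUnit hC)
  have h : cq (bl C V G) = fromBlocks (cq C) (cq V) (cq V)ᵀ (cq G) := by
    unfold cq bl; rw [fromBlocks_map]; rfl
  rw [h, det_fromBlocks₁₁, invOf_eq_nonsing_inv, sch]

theorem sch_right (C : Matrix ι ι ℤ) (V : Matrix ι κ ℤ) (G : Matrix κ κ ℤ) (T : Matrix κ l ℤ) :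
    sch C (V * T) (Tᵀ * G * T) = (cq T)ᵀ * sch C V G * cq T := by
  simp only [sch, cq_mul, Matrix.mul_sub, Matrix.sub_mul, transpose_mul, Matrix.mul_assoc,
    cq_transpose]

theorem sch_submatrix (C : Matrix ι ι ℤ) (V : Matrix ι κ ℤ) (G : Matrix κ κ ℤ) (f : l → κ) :
    sch C (V.submatrix id f) (G.submatrix f f) = (sch C V G).submatrix f f := by
  rfl

theorem sch_symm {C : Matrix ι ι ℤ} {V : Matrix ι κ ℤ} {G : Matrix κ κ ℤ} (hC : C.IsSymm)
    (hG : G.IsSymm) : (sch C V G).IsSymm := by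
  unfold Matrix.IsSymm sch
  have h1 : (cq C)ᵀ = cq C := by rw [← cq_transpose, hC.eq]
  have h2 : (cq G)ᵀ = cq G := by rw [← cq_transpose, hG.eq]
  simp only [transpose_sub, transpose_mul, transpose_transpose, transpose_nonsing_inv, h1, h2,
    Matrix.mul_assoc]

theorem sch_int (C : Matrix ι ι ℤ) (hC : C.det ≠ 0) (V : Matrix ι κ ℤ) (G : Matrix κ κ ℤ) :
    ∃ Q : Matrix κ κ ℤ, ∀ i j, (C.det : ℚ) * sch C V G i j = Q i j := by
  refine ⟨C.det • G - Vᵀ * C.adjugate * V, fun i j => ?_⟩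
  have h1 : (C.det : ℚ) • (cq C)⁻¹ = cq C.adjugate := by
    have h2 := RingHom.map_adjugate (Int.castRingHom ℚ) C
    change cq C.adjugate = adjugate (cq C) at h2
    rw [h2, Matrix.inv_def, smul_smul, cq_det, Ring.mul_inverse_cancel _ (cq_isUnit hC), one_smul]
  have h3 : (C.det : ℚ) • sch C V G = cq (C.det • G - Vᵀ * C.adjugate * V) := by
    rw [sch, smul_sub, ← Matrix.smul_mul, ← Matrix.mul_smul, h1, ← cq_transpose,
      ← cq_mul, ← cq_mul]
    ext i j
    simp only [cq_apply, Matrix.sub_apply, Matrix.smul_apply, smul_eq_mul]; push_cast; ring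
  have := congrFun (congrFun h3 i) j
  simpa [cq_apply] using this

end basic

inductive R (K : ℤ) : ∀ {ι : Type} [Fintype ι] [DecidableEq ι], Matrix ι ι ℤ → Prop
  | empty {ι : Type} [Fintype ι] [DecidableEq ι] [IsEmpty ι] (A : Matrix ι ι ℤ) : R K A
  | ext {ι : Type} [Fintype ι] [DecidableEq ι] (A : Matrix ι ι ℤ) (V : Matrix ι (Fin 1) ℤ)
      (G : Matrix (Fin 1) (Fin 1) ℤ) : R K A → (bl A V G).det ≠ 0 → |(bl A V G).det| ≤ K →
      R K (bl A V G)
  | cong {ι κ : Type} [Fintype ι] [DecidableEq ι] [Fintype κ] [DecidableEq κ]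
      (A : Matrix ι ι ℤ) (B : Matrix κ κ ℤ) : R K A → Cong A B → R K B
  | unstab {ι : Type} [Fintype ι] [DecidableEq ι] (A : Matrix ι ι ℤ) (ε : ℤ) :
      ε = 1 ∨ ε = -1 → R K (bl A 0 (diagonal fun _ : Fin 1 => ε)) → R K A

inductive PP (K : ℤ) : ∀ {ι : Type} [Fintype ι] [DecidableEq ι], Matrix ι ι ℤ → Prop
  | ext1 {ι : Type} [Fintype ι] [DecidableEq ι] (A : Matrix ι ι ℤ) (V : Matrix ι (Fin 1) ℤ)
      (G : Matrix (Fin 1) (Fin 1) ℤ) : R K A → PP K (bl A V G)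
  | ext2 {ι : Type} [Fintype ι] [DecidableEq ι] (A : Matrix ι ι ℤ) (V : Matrix ι (Fin 2) ℤ)
      (G : Matrix (Fin 2) (Fin 2) ℤ) : R K A → G.IsSymm →
      (bl A (V.submatrix id ![0]) (G.submatrix ![0] ![0])).det = 0 → PP K (bl A V G)
  | cong {ι κ : Type} [Fintype ι] [DecidableEq ι] [Fintype κ] [DecidableEq κ]
      (A : Matrix ι ι ℤ) (B : Matrix κ κ ℤ) : PP K A → Cong A B → PP K B
  | unstab {ι : Type} [Fintype ι] [DecidableEq ι] (A : Matrix ι ι ℤ) (ε : ℤ) :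
      ε = 1 ∨ ε = -1 → PP K (bl A 0 (diagonal fun _ : Fin 1 => ε)) → PP K A

section desc
variable {ι κ l : Type} [Fintype ι] [Fintype κ] [Fintype l] [DecidableEq ι] [DecidableEq κ]
  [DecidableEq l]

theorem fin1_symm (G : Matrix (Fin 1) (Fin 1) ℤ) : G.IsSymm := by
  ext i j; fin_cases i; fin_cases j; rfl

theorem absdet_unstab (A : Matrix ι ι ℤ) {ε : ℤ} (hε : ε = 1 ∨ ε = -1) :
    |(bl A 0 (diagonal fun _ : Fin 1 => ε)).det| = |A.det| := by
  have : (bl A 0 (diagonal fun _ : Fin 1 => ε)).det = A.det * ε := by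
    simp [bl]
  rw [this, abs_mul]
  rcases hε with rfl | rfl <;> simp

theorem R.good {K : ℤ} (hK : 1 ≤ K) {A : Matrix ι ι ℤ} (h : R K A) :
    A.IsSymm ∧ A.det ≠ 0 ∧ |A.det| ≤ K := by
  induction h with
  | empty A => refine ⟨?_, by simp, by simpa using hK⟩; ext i; exact isEmptyElim i
  | ext A V G hA h1 h2 ih => exact ⟨bl_symm.2 ⟨ih.1, fin1_symm G⟩, h1, h2⟩
  | cong A B hA hAB ih =>
    refine ⟨hAB.symm.symmetric ih.1, ?_, hAB.absdet ▸ ih.2.2⟩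
    rw [← abs_pos, ← hAB.absdet, abs_pos]; exact ih.2.1
  | unstab A ε hε hA ih =>
    refine ⟨(bl_symm.1 ih.1).1, ?_, absdet_unstab A hε ▸ ih.2.2⟩
    rw [← abs_pos, ← absdet_unstab A hε, abs_pos]; exact ih.2.1

theorem R.mono {K K' : ℤ} (hK : K ≤ K') {A : Matrix ι ι ℤ} (h : R K A) : R K' A := by
  induction h with
  | empty A => exact R.empty A
  | ext A V G hA h1 h2 ih => exact R.ext A V G ih h1 (h2.trans hK)
  | cong A B hA hAB ih => exact R.cong A B ih hAB
  | unstab A ε hε hA ih => exact R.unstab A ε hε ih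

theorem regroup {κ' κ'' : Type} [Fintype κ'] [Fintype κ''] [DecidableEq κ'] [DecidableEq κ'']
    (e : κ' ⊕ κ'' ≃ κ) (C : Matrix ι ι ℤ) (V : Matrix ι κ ℤ) (G : Matrix κ κ ℤ) (hG : G.IsSymm)
    (f : κ' → κ) (hf : ∀ x, e (Sum.inl x) = f x) (g : κ'' → κ) (hg : ∀ x, e (Sum.inr x) = g x) :
    Cong (bl C V G) (bl (bl C (V.submatrix id f) (G.submatrix f f))
      (fromRows (V.submatrix id g) (G.submatrix f g)) (G.submatrix g g)) := by
  refine Cong.of_submatrix ((Equiv.sumAssoc _ _ _).trans (Equiv.sumCongr (Equiv.refl _) e)) ?_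
  have hG' : ∀ i j, G i j = G j i := fun i j => congrFun (congrFun hG j) i |>.symm ▸ rfl
  ext i j
  rcases i with (i | i) | i <;> rcases j with (j | j) | j <;>
    simp [bl, hf, hg, Equiv.sumAssoc, hG' (g _) (f _)]

theorem R_step {K : ℤ} {κ' : Type} [Fintype κ'] [DecidableEq κ'] (e : κ' ⊕ Fin 1 ≃ κ)
    (C : Matrix ι ι ℤ) (V : Matrix ι κ ℤ) (G : Matrix κ κ ℤ) (hG : G.IsSymm)
    (f : κ' → κ) (hf : ∀ x, e (Sum.inl x) = f x)
    (hR : R K (bl C (V.submatrix id f) (G.submatrix f f))) (h0 : (bl C V G).det ≠ 0)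
    (h1 : |(bl C V G).det| ≤ K) : R K (bl C V G) := by
  have hc := regroup e C V G hG f hf _ (fun _ => rfl)
  refine R.cong _ _ (R.ext _ _ _ hR ?_ ?_) hc.symm
  · rw [← abs_pos, ← hc.absdet, abs_pos]; exact h0
  · rw [← hc.absdet]; exact h1

theorem PP_step {K : ℤ} {κ' : Type} [Fintype κ'] [DecidableEq κ'] (e : κ' ⊕ Fin 1 ≃ κ)
    (C : Matrix ι ι ℤ) (V : Matrix ι κ ℤ) (G : Matrix κ κ ℤ) (hG : G.IsSymm)
    (f : κ' → κ) (hf : ∀ x, e (Sum.inl x) = f x)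
    (hR : R K (bl C (V.submatrix id f) (G.submatrix f f))) : PP K (bl C V G) := by
  have hc := regroup e C V G hG f hf _ (fun _ => rfl)
  exact PP.cong _ _ (PP.ext1 _ _ _ hR) hc.symm

abbrev e11 : Fin 1 ⊕ Fin 1 ≃ Fin 2 := finSumFinEquiv
abbrev e21 : Fin 2 ⊕ Fin 1 ≃ Fin 3 := finSumFinEquiv
abbrev e12 : Fin 1 ⊕ Fin 2 ≃ Fin 3 := finSumFinEquiv

theorem e11l (x : Fin 1) : e11 (Sum.inl x) = (![0] : Fin 1 → Fin 2) x := by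
  fin_cases x; rfl
theorem e11r (x : Fin 1) : e11 (Sum.inr x) = (![1] : Fin 1 → Fin 2) x := by
  fin_cases x; rfl
theorem e21l (x : Fin 2) : e21 (Sum.inl x) = (![0, 1] : Fin 2 → Fin 3) x := by
  fin_cases x <;> rfl
theorem e12l (x : Fin 1) : e12 (Sum.inl x) = (![0] : Fin 1 → Fin 3) x := by
  fin_cases x <;> rfl
theorem e12r (x : Fin 2) : e12 (Sum.inr x) = (![1, 2] : Fin 2 → Fin 3) x := by
  fin_cases x <;> rfl

theorem H2 {K : ℤ} (C : Matrix ι ι ℤ) (V : Matrix ι (Fin 2) ℤ) (G : Matrix (Fin 2) (Fin 2) ℤ)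
    (hG : G.IsSymm) (hR : R K C)
    (h : |(bl C (V.submatrix id ![0]) (G.submatrix ![0] ![0])).det| ≤ K) : PP K (bl C V G) := by
  by_cases h0 : (bl C (V.submatrix id ![0]) (G.submatrix ![0] ![0])).det = 0
  · exact PP.ext2 _ _ _ hR hG h0
  · exact PP_step e11 C V G hG _ e11l (R.ext _ _ _ hR h0 h)

theorem H3 {K : ℤ} (C : Matrix ι ι ℤ) (V : Matrix ι (Fin 3) ℤ) (G : Matrix (Fin 3) (Fin 3) ℤ)
    (hG : G.IsSymm) (hR : R K C)
    (h0 : (bl C (V.submatrix id ![0]) (G.submatrix ![0] ![0])).det ≠ 0)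
    (h1 : |(bl C (V.submatrix id ![0]) (G.submatrix ![0] ![0])).det| ≤ K)
    (h2 : |(bl C (V.submatrix id ![0, 1]) (G.submatrix ![0, 1] ![0, 1])).det| ≤ K) :
    PP K (bl C V G) := by
  refine PP.cong _ _ (H2 _ _ _ ?_ (R.ext _ _ _ hR h0 h1) ?_)
    (regroup e12 C V G hG ![0] e12l ![1, 2] e12r).symm
  · exact hG.submatrix _
  · have hc := regroup e11 C (V.submatrix id ![0, 1]) (G.submatrix ![0, 1] ![0, 1])
      (hG.submatrix _) ![0] e11l ![1] e11r
    rw [hc.absdet] at h2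
    convert h2 using 3
    have a1 : (![0, 1] : Fin 2 → Fin 3) ∘ (![0] : Fin 1 → Fin 2) = ![0] := by
      ext x; fin_cases x; rfl
    have a2 : (![0, 1] : Fin 2 → Fin 3) ∘ (![1] : Fin 1 → Fin 2) = ![1] := by
      ext x; fin_cases x; rfl
    have a3 : (![1, 2] : Fin 2 → Fin 3) ∘ (![0] : Fin 1 → Fin 2) = ![1] := by
      ext x; fin_cases x; rfl
    simp only [submatrix_submatrix, a1, a2, a3, Function.comp_id]
    congr 1
    ext i j
    rcases i with i | i <;> fin_cases j <;> rfl

theorem det_sub (C : Matrix ι ι ℤ) (hC : C.det ≠ 0) (V : Matrix ι κ ℤ) (G : Matrix κ κ ℤ)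
    (f : l → κ) :
    ((bl C (V.submatrix id f) (G.submatrix f f)).det : ℚ) =
      C.det * ((sch C V G).submatrix f f).det := by
  rw [det_bl _ hC, sch_submatrix]

theorem stab3 (C : Matrix ι ι ℤ) (V : Matrix ι (Fin 2) ℤ) (G : Matrix (Fin 2) (Fin 2) ℤ)
    (hG : G.IsSymm) (ε : ℤ) :
    ∃ (V3 : Matrix ι (Fin 3) ℤ) (G3 : Matrix (Fin 3) (Fin 3) ℤ), G3.IsSymm ∧
      Cong (bl C V3 G3) (bl (bl C V G) 0 (diagonal fun _ : Fin 1 => ε)) ∧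
      sch C V3 G3 = !![sch C V G 0 0, sch C V G 0 1, 0; sch C V G 1 0, sch C V G 1 1, 0;
        0, 0, (ε : ℚ)] := by
  have hs : (!![G 0 0, G 0 1, 0; G 1 0, G 1 1, 0; 0, 0, ε] : Matrix (Fin 3) (Fin 3) ℤ).IsSymm := by
    ext i j; fin_cases i <;> fin_cases j <;> simp [hG.apply]
  refine ⟨of fun i => ![V i 0, V i 1, 0], !![G 0 0, G 0 1, 0; G 1 0, G 1 1, 0; 0, 0, ε], hs, ?_, ?_⟩
  · have := regroup e21 C (of fun i => ![V i 0, V i 1, 0])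
      !![G 0 0, G 0 1, 0; G 1 0, G 1 1, 0; 0, 0, ε] hs _ e21l ![2] (fun x => by fin_cases x; rfl)
    convert this using 1
    congr 1
    · congr 1
      · ext i j; fin_cases j <;> simp
      · ext i j; fin_cases i <;> fin_cases j <;> simp
    · ext i j
      rcases i with i | i <;> fin_cases j
      · rfl
      · fin_cases i <;> rfl
    · ext i j; fin_cases i; fin_cases j; rfl
  · ext i j; fin_cases i <;> fin_cases j <;>
      simp [sch, cq_apply, Matrix.mul_apply]

end desc

section desc2
variable {ι κ l : Type} [Fintype ι] [Fintype κ] [Fintype l] [DecidableEq ι] [DecidableEq κ]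
  [DecidableEq l]

/-- integral Schur complement -/
def qm (C : Matrix ι ι ℤ) (V : Matrix ι κ ℤ) (G : Matrix κ κ ℤ) : Matrix κ κ ℤ :=
  C.det • G - Vᵀ * C.adjugate * V

theorem cq_qm (C : Matrix ι ι ℤ) (hC : C.det ≠ 0) (V : Matrix ι κ ℤ) (G : Matrix κ κ ℤ) :
    cq (qm C V G) = (C.det : ℚ) • sch C V G := by
  have h1 : (C.det : ℚ) • (cq C)⁻¹ = cq C.adjugate := by
    have h2 := RingHom.map_adjugate (Int.castRingHom ℚ) C
    change cq C.adjugate = adjugate (cq C) at h2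
    rw [h2, Matrix.inv_def, smul_smul, cq_det, Ring.mul_inverse_cancel _ (cq_isUnit hC), one_smul]
  rw [sch, smul_sub, ← Matrix.smul_mul, ← Matrix.mul_smul, h1, ← cq_transpose,
      ← cq_mul, ← cq_mul, qm]
  ext i j
  simp only [cq_apply, Matrix.sub_apply, Matrix.smul_apply, smul_eq_mul]; push_cast; ring

theorem qm_det (C : Matrix ι ι ℤ) (hC : C.det ≠ 0) (V : Matrix ι κ ℤ) (G : Matrix κ κ ℤ) :
    C.det ^ (Fintype.card κ) * (bl C V G).det = C.det * (qm C V G).det := by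
  have : ((C.det ^ (Fintype.card κ) * (bl C V G).det : ℤ) : ℚ)
      = ((C.det * (qm C V G).det : ℤ) : ℚ) := by
    rw [Int.cast_mul, Int.cast_mul, Int.cast_pow, cq_det (qm C V G), cq_qm C hC, det_smul, det_bl C hC]; ring
  exact_mod_cast this

theorem qm_sub (C : Matrix ι ι ℤ) (V : Matrix ι κ ℤ) (G : Matrix κ κ ℤ) (f : l → κ) :
    qm C (V.submatrix id f) (G.submatrix f f) = (qm C V G).submatrix f f := by
  rfl

theorem qm_right (C : Matrix ι ι ℤ) (V : Matrix ι κ ℤ) (G : Matrix κ κ ℤ) (T : Matrix κ l ℤ) :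
    qm C (V * T) (Tᵀ * G * T) = Tᵀ * qm C V G * T := by
  simp only [qm, Matrix.mul_sub, Matrix.sub_mul, transpose_mul, Matrix.mul_assoc,
    Matrix.mul_smul, Matrix.smul_mul]

theorem qm_symm {C : Matrix ι ι ℤ} {V : Matrix ι κ ℤ} {G : Matrix κ κ ℤ} (hC : C.IsSymm)
    (hG : G.IsSymm) : (qm C V G).IsSymm := by
  unfold Matrix.IsSymm qm
  simp only [transpose_sub, transpose_mul, transpose_transpose, transpose_smul,
    Matrix.mul_assoc, hG.eq, adjugate_transpose, hC.eq]

theorem q1 (C : Matrix ι ι ℤ) (hC : C.det ≠ 0) (V : Matrix ι κ ℤ) (G : Matrix κ κ ℤ) (k : κ) :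
    (bl C (V.submatrix id ![k]) (G.submatrix ![k] ![k])).det = qm C V G k k := by
  have := qm_det C hC (V.submatrix id ![k]) (G.submatrix ![k] ![k])
  rw [qm_sub, det_fin_one, Fintype.card_fin, pow_one] at this
  exact mul_left_cancel₀ hC this

theorem q2 (C : Matrix ι ι ℤ) (hC : C.det ≠ 0) (V : Matrix ι κ ℤ) (G : Matrix κ κ ℤ) (i j : κ) :
    C.det * (bl C (V.submatrix id ![i, j]) (G.submatrix ![i, j] ![i, j])).det =
      qm C V G i i * qm C V G j j - qm C V G i j * qm C V G j i := by
  have := qm_det C hC (V.submatrix id ![i, j]) (G.submatrix ![i, j] ![i, j])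
  rw [qm_sub, det_fin_two] at this
  simp only [Fintype.card_fin, pow_two, mul_assoc] at this
  exact mul_left_cancel₀ hC this

theorem q2f (C : Matrix ι ι ℤ) (hC : C.det ≠ 0) (V : Matrix ι (Fin 2) ℤ)
    (G : Matrix (Fin 2) (Fin 2) ℤ) :
    C.det * (bl C V G).det =
      qm C V G 0 0 * qm C V G 1 1 - qm C V G 0 1 * qm C V G 1 0 := by
  have := qm_det C hC V G
  rw [det_fin_two] at this
  simp only [Fintype.card_fin, pow_two, mul_assoc] at this
  exact mul_left_cancel₀ hC this

theorem q3f (C : Matrix ι ι ℤ) (hC : C.det ≠ 0) (V : Matrix ι (Fin 3) ℤ)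
    (G : Matrix (Fin 3) (Fin 3) ℤ) :
    C.det ^ 2 * (bl C V G).det = (qm C V G).det := by
  have := qm_det C hC V G
  rw [Fintype.card_fin, pow_succ', mul_assoc] at this
  exact mul_left_cancel₀ hC this

theorem stab3q (C : Matrix ι ι ℤ) (hC : C.det ≠ 0) (V : Matrix ι (Fin 2) ℤ)
    (G : Matrix (Fin 2) (Fin 2) ℤ) (hG : G.IsSymm) (ε : ℤ) :
    ∃ (V3 : Matrix ι (Fin 3) ℤ) (G3 : Matrix (Fin 3) (Fin 3) ℤ), G3.IsSymm ∧
      Cong (bl C V3 G3) (bl (bl C V G) 0 (diagonal fun _ : Fin 1 => ε)) ∧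
      qm C V3 G3 = !![qm C V G 0 0, qm C V G 0 1, 0; qm C V G 1 0, qm C V G 1 1, 0;
        0, 0, C.det * ε] := by
  obtain ⟨V3, G3, h1, h2, h3⟩ := stab3 C V G hG ε
  refine ⟨V3, G3, h1, h2, cq_inj ?_⟩
  have h4 := cq_qm C hC V G
  have h5 : ∀ i j, ((qm C V G i j : ℤ) : ℚ) = C.det * sch C V G i j := fun i j => by
    have := congrFun (congrFun h4 i) j
    simpa [cq_apply] using this
  rw [cq_qm C hC, h3]
  ext i j
  fin_cases i <;> fin_cases j <;> simp [cq_apply, h5]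

theorem near (β m : ℤ) (hm : m ≠ 0) : ∃ n : ℤ, |β + 2 * m * n| ≤ |m| := by
  have hm' : 0 < |m| := abs_pos.2 hm
  have h1 := Int.emod_add_mul_ediv (β + |m|) (2 * |m|)
  have h2 := Int.emod_nonneg (β + |m|) (b := 2 * |m|) (by omega)
  have h3 := Int.emod_lt_of_pos (β + |m|) (b := 2 * |m|) (by omega)
  set q := (β + |m|) / (2 * |m|)
  rcases abs_choice m with h | h
  · refine ⟨-q, ?_⟩
    have : β + 2 * m * -q = (β + |m|) % (2 * |m|) - |m| := by
      rw [h] at h1 ⊢; linarith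
    rw [this, abs_le]; constructor <;> linarith
  · refine ⟨q, ?_⟩
    have : β + 2 * m * q = (β + |m|) % (2 * |m|) - |m| := by
      rw [h] at h1 ⊢; linarith
    rw [this, abs_le]; constructor <;> linarith

theorem chb (C : Matrix ι ι ℤ) (V : Matrix ι κ ℤ) (G : Matrix κ κ ℤ) (hG : G.IsSymm)
    (T T' : Matrix κ κ ℤ) (h : T * T' = 1) :
    ∃ (V' : Matrix ι κ ℤ) (G' : Matrix κ κ ℤ), G'.IsSymm ∧ Cong (bl C V G) (bl C V' G') ∧
      qm C V' G' = Tᵀ * qm C V G * T := by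
  refine ⟨V * T, Tᵀ * G * T, ?_, Cong.bl_right C V G _ _ h, qm_right C V G T⟩
  unfold Matrix.IsSymm
  simp only [transpose_mul, transpose_transpose, hG.eq, Matrix.mul_assoc]

theorem lemmaZ {K : ℤ} (hK : 1 ≤ K) (C : Matrix ι ι ℤ) (V : Matrix ι (Fin 2) ℤ)
    (G : Matrix (Fin 2) (Fin 2) ℤ) (hG : G.IsSymm) (hR : R K C)
    (h0 : (bl C (V.submatrix id ![0]) (G.submatrix ![0] ![0])).det = 0)
    (he : (bl C V G).det ≠ 0) (heK : |(bl C V G).det| ≤ K) : R K (bl C V G) := by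
  obtain ⟨hCs, hC, hCK⟩ := hR.good hK
  have hQs := qm_symm (V := V) hCs hG
  rw [q1 C hC] at h0
  have h10 : qm C V G 1 0 = qm C V G 0 1 := hQs.apply 0 1
  have hdet := q2f C hC V G
  rw [h10, h0, zero_mul, zero_sub] at hdet
  obtain ⟨m, hm⟩ : ∃ m, qm C V G 0 1 = m := ⟨_, rfl⟩
  obtain ⟨β, hβ⟩ : ∃ β, qm C V G 1 1 = β := ⟨_, rfl⟩
  rw [hm] at hdet h10
  have hm0 : m ≠ 0 := by
    rintro rfl; simp at hdet; tauto
  have hmK : |m| ≤ K := by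
    have h1 : |m| * |m| = |C.det| * |(bl C V G).det| := by
      rw [← abs_mul, ← abs_mul, hdet, abs_neg]
    have := abs_nonneg C.det
    have := abs_nonneg (bl C V G).det
    have := abs_nonneg m
    nlinarith
  obtain ⟨n, hn⟩ := near β m hm0
  obtain ⟨V', G', hG', hc, hq⟩ := chb C V G hG !![n, 1; 1, 0] !![0, 1; 1, -n] (by
    ext i j; fin_cases i <;> fin_cases j <;> simp [Matrix.mul_apply, Fin.sum_univ_succ])
  have hq' : qm C V' G' = !![β + 2 * m * n, m; m, 0] := by
    rw [hq]
    ext i j; fin_cases i <;> fin_cases j <;>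
      simp [Matrix.mul_apply, Fin.sum_univ_succ, h0, hm, h10, hβ] <;> ring
  by_cases hd : β + 2 * m * n = 0
  · obtain ⟨V3, G3, hG3, hc3, hq3⟩ := stab3q C hC V' G' hG' 1
    obtain ⟨V4, G4, hG4, hc4, hq4⟩ := chb C V3 G3 hG3 !![1, 0, 0; 0, 1, 0; 1, 0, 1]
        !![1, 0, 0; 0, 1, 0; -1, 0, 1] (by
      ext i j; fin_cases i <;> fin_cases j <;> simp [Matrix.mul_apply, Fin.sum_univ_succ])
    refine R.cong _ _ (R.unstab _ 1 (Or.inl rfl) (R.cong _ _ ?_ (hc4.symm.trans hc3))) hc.symm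
    have hfull := (hc4.absdet.symm.trans (hc3.absdet.trans ((absdet_unstab _ (Or.inl rfl)).trans
      hc.absdet.symm)))
    have e00 : qm C V4 G4 0 0 = C.det := by
      rw [hq4, hq3, hq', hd]; simp [Matrix.mul_apply, Fin.sum_univ_succ]
    have e01 : qm C V4 G4 0 1 = m := by
      rw [hq4, hq3, hq', hd]; simp [Matrix.mul_apply, Fin.sum_univ_succ]
    have e10 : qm C V4 G4 1 0 = m := by
      rw [hq4, hq3, hq', hd]; simp [Matrix.mul_apply, Fin.sum_univ_succ]
    have e11' : qm C V4 G4 1 1 = 0 := by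
      rw [hq4, hq3, hq', hd]; simp [Matrix.mul_apply, Fin.sum_univ_succ]
    have d2 : (bl C (V4.submatrix id ![0, 1]) (G4.submatrix ![0, 1] ![0, 1])).det
        = (bl C V G).det := by
      have := q2 C hC V4 G4 0 1
      rw [e00, e01, e10, e11', mul_zero, zero_sub, ← hdet] at this
      exact mul_left_cancel₀ hC this
    have a1 : (![0, 1] : Fin 2 → Fin 3) ∘ (![0] : Fin 1 → Fin 2) = ![0] := by
      ext x; fin_cases x; rfl
    refine R_step e21 C V4 G4 hG4 _ e21l (R_step e11 C _ _ (hG4.submatrix _) _ e11l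
      (R.ext _ _ _ hR ?_ ?_) ?_ ?_) ?_ ?_
    · rw [submatrix_submatrix, submatrix_submatrix, a1, Function.comp_id, q1 C hC, e00]; exact hC
    · rw [submatrix_submatrix, submatrix_submatrix, a1, Function.comp_id, q1 C hC, e00]; exact hCK
    · rw [d2]; exact he
    · rw [d2]; exact heK
    · rw [← abs_pos, hfull, abs_pos]; exact he
    · rw [hfull]; exact heK
  · have h11 : qm C V' G' 0 0 = β + 2 * m * n := by rw [hq']; rfl
    refine R.cong _ _ (R_step e11 C _ _ hG' _ e11l (R.ext _ _ _ hR ?_ ?_) ?_ ?_) hc.symm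
    · rw [q1 C hC, h11]; exact hd
    · rw [q1 C hC, h11]; exact hn.trans hmK
    · rw [← abs_pos, ← hc.absdet, abs_pos]; exact he
    · rw [← hc.absdet]; exact heK

end desc2

section desc3
variable {ι κ l : Type} [Fintype ι] [Fintype κ] [Fintype l] [DecidableEq ι] [DecidableEq κ]
  [DecidableEq l]

theorem arith1 {M c α m β e : ℤ} (hα : |α| = M) (hM : 2 ≤ M) (hc : c ≠ 0) (hcM : |c| ≤ M - 1)
    (he : |e| ≤ M) (hm : 2 * |m| ≤ M) (h : α * β - m * m = c * e) (hβ : M ≤ |β|) :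
    ∃ ε : ℤ, (ε = 1 ∨ ε = -1) ∧ α + ε * c ≠ 0 ∧ |α + ε * c| ≤ M - 1 ∧ |e + ε * β| ≤ M - 1 := by
  have hc0 : 0 < |c| := abs_pos.2 hc
  have hmm : 4 * |m| * |m| ≤ M * M := by nlinarith [abs_nonneg m]
  have h1 : M * |β| ≤ |m| * |m| + |c| * |e| := by
    rw [← hα, ← abs_mul, ← abs_mul, ← abs_mul]
    have : α * β = m * m + c * e := by linarith
    rw [this]; exact abs_add_le _ _
  have h2 : 3 * M ≤ 4 * |c| := by
    have : |c| * |e| ≤ |c| * M := by gcongr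
    nlinarith
  obtain ⟨ε, hε, hεc⟩ : ∃ ε : ℤ, (ε = 1 ∨ ε = -1) ∧ |α + ε * c| = M - |c| := by
    rcases abs_cases α with ⟨h3, _⟩ | ⟨h3, _⟩ <;> rcases abs_cases c with ⟨h4, _⟩ | ⟨h4, _⟩
    · exact ⟨-1, by simp, by rw [abs_of_nonneg] <;> linarith⟩
    · exact ⟨1, by simp, by rw [abs_of_nonneg] <;> linarith⟩
    · exact ⟨1, by simp, by rw [abs_of_nonpos] <;> linarith⟩
    · exact ⟨-1, by simp, by rw [abs_of_nonpos] <;> linarith⟩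
  refine ⟨ε, hε, ?_, ?_, ?_⟩
  · rw [← abs_pos, hεc]; linarith
  · rw [hεc]; linarith
  · have h5 : M * |e + ε * β| ≤ |e| * |α + ε * c| + |m| * |m| := by
      rw [← hα, ← abs_mul, ← abs_mul]
      have h6 : α * (e + ε * β) = e * (α + ε * c) + ε * (m * m) := by
        linear_combination ε * h
      have h7 : |ε * (m * m)| = |m| * |m| := by
        rw [abs_mul, abs_mul]; rcases hε with rfl | rfl <;> simp
      rw [h6, ← h7]; exact abs_add_le _ _
    rw [hεc] at h5
    have h8 : |e| * (M - |c|) ≤ M * (M - |c|) := by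
      apply mul_le_mul_of_nonneg_right he; linarith
    have h9 : M * (2 * |e + ε * β|) ≤ M * M := by nlinarith
    have := le_of_mul_le_mul_left h9 (by linarith)
    linarith

theorem extext {K : ℤ} (hK : 1 ≤ K) (C : Matrix ι ι ℤ) (V : Matrix ι (Fin 2) ℤ)
    (G : Matrix (Fin 2) (Fin 2) ℤ) (hG : G.IsSymm) (hR : R K C)
    (h0 : |(bl C (V.submatrix id ![0]) (G.submatrix ![0] ![0])).det| = K + 1)
    (heK : |(bl C V G).det| ≤ K + 1) : PP K (bl C V G) := by
  obtain ⟨hCs, hC, hCK⟩ := hR.good hK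
  have hQs := qm_symm (V := V) hCs hG
  rw [q1 C hC] at h0
  have h10 : qm C V G 1 0 = qm C V G 0 1 := hQs.apply 0 1
  have hdet := q2f C hC V G
  obtain ⟨m, hm⟩ : ∃ m, qm C V G 0 1 = m := ⟨_, rfl⟩
  obtain ⟨β, hβ⟩ : ∃ β, qm C V G 1 1 = β := ⟨_, rfl⟩
  obtain ⟨α, hα⟩ : ∃ α, qm C V G 0 0 = α := ⟨_, rfl⟩
  rw [h10, hm, hβ, hα] at hdet
  rw [hm] at h10
  rw [hα] at h0
  obtain ⟨n, hn⟩ := near (2 * m) α (by rintro rfl; simp at h0; omega)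
  obtain ⟨β', hβ'⟩ : ∃ β', β + 2 * m * n + α * n * n = β' := ⟨_, rfl⟩
  obtain ⟨m', hm'⟩ : ∃ m', m + α * n = m' := ⟨_, rfl⟩
  have hdet' : α * β' - m' * m' = C.det * (bl C V G).det := by
    rw [hdet, ← hβ', ← hm']; ring
  have hmM : 2 * |m'| ≤ K + 1 := by
    have : 2 * m + 2 * α * n = 2 * m' := by rw [← hm']; ring
    rw [this, abs_mul, h0] at hn; simpa using hn
  by_cases hb : |β'| ≤ K
  · obtain ⟨V', G', hG', hc, hq⟩ := chb C V G hG !![n, 1; 1, 0] !![0, 1; 1, -n] (by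
      ext i j; fin_cases i <;> fin_cases j <;> simp [Matrix.mul_apply, Fin.sum_univ_succ])
    have hq' : qm C V' G' 0 0 = β' := by
      rw [hq, ← hβ']
      simp [Matrix.mul_apply, Fin.sum_univ_succ, hα, hm, h10, hβ]; ring
    refine PP.cong _ _ (H2 C V' G' hG' hR ?_) hc.symm
    rw [q1 C hC, hq']; exact hb
  · obtain ⟨ε, hε, a1, a2, a3⟩ := arith1 h0 (by omega) hC (by omega) heK hmM hdet' (by omega)
    obtain ⟨V', G', hG', hc, hq⟩ := chb C V G hG !![1, n; 0, 1] !![1, -n; 0, 1] (by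
      ext i j; fin_cases i <;> fin_cases j <;> simp [Matrix.mul_apply, Fin.sum_univ_succ])
    have hq' : qm C V' G' = !![α, m'; m', β'] := by
      rw [hq, ← hβ', ← hm']
      ext i j; fin_cases i <;> fin_cases j <;>
        simp [Matrix.mul_apply, Fin.sum_univ_succ, hm, h10, hβ, hα] <;> ring
    obtain ⟨V3, G3, hG3, hc3, hq3⟩ := stab3q C hC V' G' hG' ε
    obtain ⟨V4, G4, hG4, hc4, hq4⟩ := chb C V3 G3 hG3 !![1, 0, 0; 0, 1, 0; 1, 0, 1]
        !![1, 0, 0; 0, 1, 0; -1, 0, 1] (by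
      ext i j; fin_cases i <;> fin_cases j <;> simp [Matrix.mul_apply, Fin.sum_univ_succ])
    refine PP.cong _ _ (PP.unstab _ ε hε (PP.cong _ _ ?_ (hc4.symm.trans hc3))) hc.symm
    have e00 : qm C V4 G4 0 0 = α + ε * C.det := by
      rw [hq4, hq3, hq']; simp [Matrix.mul_apply, Fin.sum_univ_succ]; ring
    have e01 : qm C V4 G4 0 1 = m' := by
      rw [hq4, hq3, hq']; simp [Matrix.mul_apply, Fin.sum_univ_succ]
    have e10 : qm C V4 G4 1 0 = m' := by
      rw [hq4, hq3, hq']; simp [Matrix.mul_apply, Fin.sum_univ_succ]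
    have e11' : qm C V4 G4 1 1 = β' := by
      rw [hq4, hq3, hq']; simp [Matrix.mul_apply, Fin.sum_univ_succ]
    have d2 : (bl C (V4.submatrix id ![0, 1]) (G4.submatrix ![0, 1] ![0, 1])).det
        = (bl C V G).det + ε * β' := by
      have := q2 C hC V4 G4 0 1
      rw [e00, e01, e10, e11'] at this
      refine mul_left_cancel₀ hC ?_
      rw [this, mul_add, ← hdet']; ring
    refine H3 C V4 G4 hG4 hR ?_ ?_ ?_
    · rw [q1 C hC, e00]; exact a1
    · rw [q1 C hC, e00]; simpa using a2
    · rw [d2]; simpa using a3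

theorem ext2ext {K : ℤ} (hK : 1 ≤ K) (C : Matrix ι ι ℤ) (V : Matrix ι (Fin 3) ℤ)
    (G : Matrix (Fin 3) (Fin 3) ℤ) (hG : G.IsSymm) (hR : R K C)
    (h0 : (bl C (V.submatrix id ![0]) (G.submatrix ![0] ![0])).det = 0)
    (h1 : |(bl C (V.submatrix id ![0, 1]) (G.submatrix ![0, 1] ![0, 1])).det| = K + 1)
    (he : (bl C V G).det ≠ 0)
    (heK : |(bl C V G).det| ≤ K + 1) : PP K (bl C V G) := by
  obtain ⟨hCs, hC, hCK⟩ := hR.good hK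
  have hQs := qm_symm (V := V) hCs hG
  rw [q1 C hC] at h0
  have h10 : qm C V G 1 0 = qm C V G 0 1 := hQs.apply 0 1
  have h20 : qm C V G 2 0 = qm C V G 0 2 := hQs.apply 0 2
  have h21 : qm C V G 2 1 = qm C V G 1 2 := hQs.apply 1 2
  have hf := q2 C hC V G 0 1
  have hdet := q3f C hC V G
  rw [det_fin_three] at hdet
  obtain ⟨f, hf'⟩ : ∃ f, (bl C (V.submatrix id ![0, 1]) (G.submatrix ![0, 1] ![0, 1])).det = f :=
    ⟨_, rfl⟩
  obtain ⟨b, hb⟩ : ∃ b, qm C V G 0 1 = b := ⟨_, rfl⟩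
  obtain ⟨x, hx⟩ : ∃ x, qm C V G 0 2 = x := ⟨_, rfl⟩
  obtain ⟨d, hd⟩ : ∃ d, qm C V G 1 1 = d := ⟨_, rfl⟩
  obtain ⟨y, hy⟩ : ∃ y, qm C V G 1 2 = y := ⟨_, rfl⟩
  obtain ⟨z, hz⟩ : ∃ z, qm C V G 2 2 = z := ⟨_, rfl⟩
  rw [hb] at h10; rw [hx] at h20; rw [hy] at h21
  rw [hf'] at h1
  rw [hf', h0, hb, h10] at hf
  rw [h0, hb, h10, hx, hd, hy, hz, h20, h21] at hdet
  have hf0 : f ≠ 0 := by rintro rfl; simp at h1; omega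
  have hb0 : b ≠ 0 := by
    rintro rfl; simp at hf; tauto
  obtain ⟨n, hn⟩ := near (2 * x) b hb0
  obtain ⟨x', hx'⟩ : ∃ x', x + b * n = x' := ⟨_, rfl⟩
  have hxb : 2 * |x'| ≤ |b| := by
    have : 2 * x + 2 * b * n = 2 * x' := by rw [← hx']; ring
    rw [this, abs_mul] at hn; simpa using hn
  by_cases hx0 : x' = 0
  · obtain ⟨V', G', hG', hc, hq⟩ := chb C V G hG !![0, 1, 0; n, 0, 1; 1, 0, 0]
      !![0, 0, 1; 1, 0, 0; 0, 1, -n] (by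
      ext i j; fin_cases i <;> fin_cases j <;> simp [Matrix.mul_apply, Fin.sum_univ_succ])
    obtain ⟨z', hz'⟩ : ∃ z', z + 2 * n * y + n * n * d = z' := ⟨_, rfl⟩
    have e00 : qm C V' G' 0 0 = z' := by
      rw [hq]; simp [Matrix.mul_apply, Fin.sum_univ_succ, *]; linarith
    have e01 : qm C V' G' 0 1 = 0 := by
      rw [hq]; simp [Matrix.mul_apply, Fin.sum_univ_succ, *]; linarith
    have e11' : qm C V' G' 1 1 = 0 := by
      rw [hq]; simp [Matrix.mul_apply, Fin.sum_univ_succ, *]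
    have hzz : C.det * (bl C V G).det = f * z' := by
      refine mul_left_cancel₀ hC ?_
      have hxx : x = - b * n := by linarith
      rw [← mul_assoc, ← mul_assoc, ← pow_two, hdet, hf, ← hz', hxx]; ring
    have hz0 : z' ≠ 0 := by
      rintro rfl; simp at hzz; tauto
    have hzK : |z'| ≤ K := by
      have h5 : |C.det| * |(bl C V G).det| = (K + 1) * |z'| := by
        rw [← h1, ← abs_mul, ← abs_mul, hzz]
      have h6 : |C.det| * |(bl C V G).det| ≤ K * (K + 1) := by gcongr
      nlinarith
    refine PP.cong _ _ (H3 C V' G' hG' hR ?_ ?_ ?_) hc.symm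
    · rw [q1 C hC, e00]; exact hz0
    · rw [q1 C hC, e00]; exact hzK
    · have h7 := q2 C hC V' G' 0 1
      rw [e01, e11'] at h7
      simp only [mul_zero, zero_mul, sub_zero] at h7
      rw [(mul_eq_zero.1 h7).resolve_left hC]; simp; omega
  · obtain ⟨V', G', hG', hc, hq⟩ := chb C V G hG !![1, 0, 0; 0, n, 1; 0, 1, 0]
      !![1, 0, 0; 0, 0, 1; 0, 1, -n] (by
      ext i j; fin_cases i <;> fin_cases j <;> simp [Matrix.mul_apply, Fin.sum_univ_succ])
    have e00 : qm C V' G' 0 0 = 0 := by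
      rw [hq]; simp [Matrix.mul_apply, Fin.sum_univ_succ, *]
    have e01 : qm C V' G' 0 1 = x' := by
      rw [hq]; simp [Matrix.mul_apply, Fin.sum_univ_succ, *]; linarith
    have e10 : qm C V' G' 1 0 = x' := by
      rw [hq]; simp [Matrix.mul_apply, Fin.sum_univ_succ, *]; linarith
    have a1 : (![0, 1] : Fin 2 → Fin 3) ∘ (![0] : Fin 1 → Fin 2) = ![0] := by
      ext x; fin_cases x; rfl
    have h7 := q2 C hC V' G' 0 1
    rw [e00, e01, e10, zero_mul, zero_sub] at h7
    refine PP.cong _ _ (PP_step e21 C V' G' hG' _ e21l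
      (lemmaZ hK C _ _ (hG'.submatrix _) hR ?_ ?_ ?_)) hc.symm
    · rw [submatrix_submatrix, submatrix_submatrix, a1, Function.comp_id, q1 C hC, e00]
    · intro h8
      rw [h8] at h7; simp at h7; tauto
    · obtain ⟨f', hf''⟩ : ∃ f,
        (bl C (V'.submatrix id ![0, 1]) (G'.submatrix ![0, 1] ![0, 1])).det = f := ⟨_, rfl⟩
      rw [hf''] at h7 ⊢
      have h8 : |C.det| * |f'| = |x'| * |x'| := by
        rw [← abs_mul, h7, abs_neg, abs_mul]
      have h9 : |C.det| * |f| = |b| * |b| := by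
        rw [← abs_mul, hf, zero_mul, zero_sub, abs_neg, abs_mul]
      have h10 : |C.det| * (4 * |f'|) ≤ |C.det| * |f| := by
        nlinarith [abs_nonneg x']
      have h11 := le_of_mul_le_mul_left h10 (abs_pos.2 hC)
      omega

end desc3

section desc4
variable {ι κ l : Type} [Fintype ι] [Fintype κ] [Fintype l] [DecidableEq ι] [DecidableEq κ]
  [DecidableEq l]

theorem PP.toR {K : ℤ} (hK : 1 ≤ K) {A : Matrix ι ι ℤ} (h : PP K A) (h0 : A.det ≠ 0)
    (h1 : |A.det| ≤ K) : R K A := by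
  induction h with
  | ext1 A V G hR => exact R.ext _ _ _ hR h0 h1
  | ext2 A V G hR hG hd => exact lemmaZ hK _ _ _ hG hR hd h0 h1
  | cong A B hA hAB ih =>
    refine R.cong _ _ (ih ?_ ?_) hAB
    · rw [← abs_pos, hAB.absdet, abs_pos]; exact h0
    · rw [hAB.absdet]; exact h1
  | unstab A ε hε hA ih =>
    refine R.unstab _ ε hε (ih ?_ ?_)
    · rw [← abs_pos, absdet_unstab A hε, abs_pos]; exact h0
    · rw [absdet_unstab A hε]; exact h1

theorem ungroup {κ' κ'' : Type} [Fintype κ'] [Fintype κ''] [DecidableEq κ'] [DecidableEq κ'']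
    (e : κ' ⊕ κ'' ≃ κ) (C : Matrix ι ι ℤ) (V : Matrix ι κ' ℤ) (G : Matrix κ' κ' ℤ) (hG : G.IsSymm)
    (V' : Matrix (ι ⊕ κ') κ'' ℤ) (G' : Matrix κ'' κ'' ℤ) (hG' : G'.IsSymm)
    (f : κ' → κ) (hf : ∀ x, e (Sum.inl x) = f x) :
    ∃ (V2 : Matrix ι κ ℤ) (G2 : Matrix κ κ ℤ), G2.IsSymm ∧ V2.submatrix id f = V ∧
      G2.submatrix f f = G ∧ Cong (bl (bl C V G) V' G') (bl C V2 G2) := by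
  have hf' : ∀ x, e.symm (f x) = Sum.inl x := fun x => by rw [← hf]; simp
  refine ⟨(fromCols V V'.toRows₁).submatrix id e.symm, (bl G V'.toRows₂ G').submatrix e.symm e.symm,
    (bl_symm.2 ⟨hG, hG'⟩).submatrix _, ?_, ?_, ?_⟩
  · ext i j; simp [hf']
  · ext i j; simp [hf', bl]
  · refine Cong.symm (Cong.of_submatrix
      ((Equiv.sumAssoc _ _ _).trans (Equiv.sumCongr (Equiv.refl _) e)) ?_)
    ext i j
    rcases i with (i | i) | i <;> rcases j with (j | j) | j <;>
      simp [bl, Equiv.sumAssoc]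

theorem swap_unstab (A : Matrix ι ι ℤ) (V : Matrix ι κ ℤ) (G : Matrix κ κ ℤ) (E : Matrix l l ℤ) :
    Cong (bl (bl A 0 E) (fromRows V 0) G) (bl (bl A V G) 0 E) := by
  refine Cong.of_submatrix ((Equiv.sumAssoc _ _ _).trans
    ((Equiv.sumCongr (Equiv.refl _) (Equiv.sumComm _ _)).trans (Equiv.sumAssoc _ _ _).symm)) ?_
  ext i j
  rcases i with (i | i) | i <;> rcases j with (j | j) | j <;>
      simp [bl, Equiv.sumAssoc]

theorem PP.step {K : ℤ} (hK : 1 ≤ K) {A : Matrix ι ι ℤ} (h : PP K A) :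
    ∀ (V : Matrix ι (Fin 1) ℤ) (G : Matrix (Fin 1) (Fin 1) ℤ), |A.det| = K + 1 →
      (bl A V G).det ≠ 0 → |(bl A V G).det| ≤ K + 1 → PP K (bl A V G) := by
  induction h with
  | ext1 C V0 G0 hR =>
    intro V G h1 h2 h3
    obtain ⟨V2, G2, hG2, e1, e2, hc⟩ := ungroup e11 C V0 G0 (fin1_symm _) V G (fin1_symm _) _ e11l
    refine PP.cong _ _ (extext hK C V2 G2 hG2 hR ?_ ?_) hc.symm
    · rw [e1, e2]; exact h1
    · rw [← hc.absdet]; exact h3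
  | ext2 C V0 G0 hR hG0 hd =>
    intro V G h1 h2 h3
    obtain ⟨V2, G2, hG2, e1, e2, hc⟩ := ungroup e21 C V0 G0 hG0 V G (fin1_symm _) _ e21l
    have a1 : (![0, 1] : Fin 2 → Fin 3) ∘ (![0] : Fin 1 → Fin 2) = ![0] := by
      ext x; fin_cases x; rfl
    refine PP.cong _ _ (ext2ext hK C V2 G2 hG2 hR ?_ ?_ ?_ ?_) hc.symm
    · rw [← e1, ← e2, submatrix_submatrix, submatrix_submatrix, a1, Function.comp_id] at hd
      exact hd
    · rw [e1, e2]; exact h1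
    · rw [← abs_pos, ← hc.absdet, abs_pos]; exact h2
    · rw [← hc.absdet]; exact h3
  | cong A B hA hAB ih =>
    intro V G h1 h2 h3
    obtain ⟨V', hc⟩ := hAB.symm.bl_left V G
    refine PP.cong _ _ (ih V' G ?_ ?_ ?_) hc.symm
    · rw [hAB.absdet]; exact h1
    · rw [← abs_pos, ← hc.absdet, abs_pos]; exact h2
    · rw [← hc.absdet]; exact h3
  | unstab A ε hε hA ih =>
    intro V G h1 h2 h3
    have hc := swap_unstab A V G (diagonal fun _ : Fin 1 => ε)
    refine PP.unstab _ ε hε (PP.cong _ _ (ih _ _ ?_ ?_ ?_) hc)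
    · rw [absdet_unstab A hε]; exact h1
    · rw [← abs_pos, hc.absdet, absdet_unstab _ hε, abs_pos]; exact h2
    · rw [hc.absdet, absdet_unstab _ hε]; exact h3

theorem R.desc {K : ℤ} (hK : 1 ≤ K) {A : Matrix ι ι ℤ} (h : R (K + 1) A) : R K A ∨ PP K A := by
  induction h with
  | empty A => exact Or.inl (R.empty A)
  | ext A V G hA h0 h1 ih =>
    right
    rcases ih with ih | ih
    · exact PP.ext1 _ _ _ ih
    · obtain ⟨_, g1, g2⟩ := hA.good (by omega)
      by_cases g3 : |A.det| ≤ K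
      · exact PP.ext1 _ _ _ (ih.toR hK g1 g3)
      · exact ih.step hK _ _ (by omega) h0 h1
  | cong A B hA hAB ih => exact ih.imp (fun h => R.cong _ _ h hAB) (fun h => PP.cong _ _ h hAB)
  | unstab A ε hε hA ih =>
    exact ih.imp (fun h => R.unstab _ _ hε h) (fun h => PP.unstab _ _ hε h)

theorem R.one {A : Matrix ι ι ℤ} (hA : |A.det| = 1) (n : ℕ) (h : R (n + 1) A) : R 1 A := by
  induction n with
  | zero => simpa using h
  | succ n ih =>
    apply ih
    push_cast at h
    rcases R.desc (by omega) h with h | h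
    · exact h
    · refine h.toR (by omega) ?_ (by omega)
      intro h0; simp [h0] at hA

theorem initial_step {n : ℕ} (A : Matrix (Fin (n + 1)) (Fin (n + 1)) ℤ) (hA : A.IsSymm) (i)
    (h : A.adjugate i i ≠ 0)
    (ih : ∀ A : Matrix (Fin n) (Fin n) ℤ, A.IsSymm → A.det ≠ 0 → ∃ M : ℤ, R M A)
    (h0 : A.det ≠ 0) : ∃ M : ℤ, R M A := by
  rw [Matrix.adjugate_fin_succ_eq_det_submatrix] at h
  obtain ⟨M, hM⟩ := ih (A.submatrix i.succAbove i.succAbove) (hA.submatrix _)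
    (fun h' => h (by rw [h']; simp))
  let e : Fin n ⊕ Fin 1 ≃ Fin (n + 1) :=
    ((Equiv.sumCongr (Equiv.refl _) (Equiv.equivPUnit.{1, 1} (Fin 1))).trans
      (Equiv.optionEquivSumPUnit (Fin n)).symm).trans (finSuccEquiv' i).symm
  have e1 : ∀ j, e (Sum.inl j) = i.succAbove j := fun j => by simp [e]
  have e2 : ∀ j, e (Sum.inr j) = i := fun j => by simp [e]
  have hc : Cong A (bl (A.submatrix i.succAbove i.succAbove)
      (A.submatrix i.succAbove (fun _ : Fin 1 => i)) (A.submatrix (fun _ => i) (fun _ => i))) := by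
    refine Cong.of_submatrix e ?_
    ext a b
    rcases a with a | a <;> rcases b with b | b <;> simp [bl, e1, e2, hA.apply]
  refine ⟨max M |A.det|, R.cong _ _ (R.ext _ _ _ (hM.mono (le_max_left _ _)) ?_ ?_) hc.symm⟩
  · rw [← abs_pos, ← hc.absdet, abs_pos]; exact h0
  · rw [← hc.absdet]; exact le_max_right _ _

theorem R.init : ∀ {n : ℕ} (A : Matrix (Fin n) (Fin n) ℤ), A.IsSymm → A.det ≠ 0 → ∃ M : ℤ, R M A
  | 0, A, _, _ => ⟨0, R.empty A⟩
  | n + 1, A, hA, h0 => by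
    by_cases h : ∃ i, A.adjugate i i ≠ 0
    · obtain ⟨i, hi⟩ := h
      exact initial_step A hA i hi (fun A => R.init A) h0
    · push Not at h
      have hadj : A.adjugate ≠ 0 := by
        intro h1
        have h2 := Matrix.mul_adjugate A
        rw [h1, Matrix.mul_zero] at h2
        have := congrFun (congrFun h2 0) 0
        simp at this; tauto
      obtain ⟨i, j, hij⟩ : ∃ i j, A.adjugate i j ≠ 0 := by
        by_contra h1; push Not at h1; exact hadj (by ext i j; exact h1 i j)
      have hne : i ≠ j := by rintro rfl; exact hij (h i)
      have hs : A.adjugate j i = A.adjugate i j := by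
        have : (A.adjugate)ᵀ = A.adjugate := by rw [adjugate_transpose, hA.eq]
        exact congrFun (congrFun this i) j
      set T := transvection i j (-1 : ℤ) with hT
      set U := transvection i j (1 : ℤ) with hU
      have hTU : T * U = 1 := by
        rw [hT, hU, transvection_mul_transvection_same _ _ hne]; simp
      have hUT : U * T = 1 := mul_eq_one_comm.1 hTU
      have hadT : T.adjugate = U := by
        calc T.adjugate = T.adjugate * (T * U) := by rw [hTU, Matrix.mul_one]
          _ = U := by rw [← Matrix.mul_assoc, adjugate_mul, hT, det_transvection_of_ne _ _ hne,
                one_smul, Matrix.one_mul]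
      have hc : Cong A (Tᵀ * A * T) := Cong.symm ⟨T, U, hUT, hTU, rfl⟩
      have hA' : (Tᵀ * A * T).IsSymm := hc.symm.symmetric hA
      obtain ⟨M, hM⟩ := initial_step (Tᵀ * A * T) hA' i (by
        rw [adjugate_mul_distrib, adjugate_mul_distrib, ← adjugate_transpose, hadT, hU]
        have : (transvection i j (1:ℤ) * (A.adjugate * (transvection i j (1:ℤ))ᵀ)) i i
          = 2 * A.adjugate i j := by
          rw [← transpose_transpose (A.adjugate * (transvection i j (1:ℤ))ᵀ), transpose_mul,
            transpose_transpose, transvection_mul_apply_same, transpose_apply, transpose_apply]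
          rw [transvection_mul_apply_same, transvection_mul_apply_same]
          simp [h, hs]
          ring
        rw [this]; simpa using hij) (fun A => R.init A) (by
          rw [← abs_pos, ← hc.absdet, abs_pos]; exact h0)
      exact ⟨M, R.cong _ _ hM hc.symm⟩

theorem R.unimod {n : ℕ} (A : Matrix (Fin n) (Fin n) ℤ) (hA : A.IsSymm) (h : |A.det| = 1) :
    R 1 A := by
  obtain ⟨M, hM⟩ := R.init A hA (by intro h0; simp [h0] at h)
  exact R.one h M.natAbs (hM.mono (by omega))

end desc4

section sd
variable {ι κ l : Type} [Fintype ι] [Fintype κ] [Fintype l] [DecidableEq ι] [DecidableEq κ]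
  [DecidableEq l]

def PM {κ : Type} (D : κ → ℤ) : Prop := ∀ i, D i = 1 ∨ D i = -1

def SD (A : Matrix ι ι ℤ) : Prop :=
  ∃ (a b : ℕ) (D : Fin a → ℤ) (D' : Fin b → ℤ), PM D ∧ PM D' ∧
    Cong (fromBlocks A 0 0 (diagonal D)) (diagonal D')

theorem SD.mk' {A : Matrix ι ι ℤ} (D : κ → ℤ) (D' : l → ℤ) (h : PM D) (h' : PM D')
    (hc : Cong (fromBlocks A 0 0 (diagonal D)) (diagonal D')) : SD A := by
  refine ⟨_, _, D ∘ (Fintype.equivFin κ).symm, D' ∘ (Fintype.equivFin l).symm, fun i => h _,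
    fun i => h' _, ?_⟩
  have h1 : Cong (diagonal D) (diagonal (D ∘ (Fintype.equivFin κ).symm)) :=
    Cong.of_submatrix (Fintype.equivFin κ).symm (by rw [submatrix_diagonal_equiv])
  have h2 : Cong (diagonal D') (diagonal (D' ∘ (Fintype.equivFin l).symm)) :=
    Cong.of_submatrix (Fintype.equivFin l).symm (by rw [submatrix_diagonal_equiv])
  exact ((Cong.refl A).sum h1.symm).trans (hc.trans h2)

theorem sum_assoc (A : Matrix ι ι ℤ) (B : Matrix κ κ ℤ) (E : Matrix l l ℤ) :
    Cong (fromBlocks (fromBlocks A 0 0 B) 0 0 E) (fromBlocks A 0 0 (fromBlocks B 0 0 E)) := by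
  refine Cong.of_submatrix (Equiv.sumAssoc _ _ _).symm ?_
  ext i j
  rcases i with i | i | i <;> rcases j with j | j | j <;> simp [Equiv.sumAssoc]

theorem sum_comm' (A : Matrix ι ι ℤ) (B : Matrix κ κ ℤ) :
    Cong (fromBlocks A 0 0 B) (fromBlocks B 0 0 A) := by
  refine Cong.of_submatrix (Equiv.sumComm _ _) ?_
  ext i j
  rcases i with i | i <;> rcases j with j | j <;> simp

theorem bl_unimod (A : Matrix ι ι ℤ) (hA : A.IsSymm) (h : |A.det| = 1) (V : Matrix ι κ ℤ)
    (G : Matrix κ κ ℤ) : ∃ G' : Matrix κ κ ℤ, Cong (bl A V G) (fromBlocks A 0 0 G') := by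
  have hu : IsUnit A.det := Int.isUnit_iff_abs_eq.2 h
  have hinv : A⁻¹ᵀ = A⁻¹ := by rw [transpose_nonsing_inv, hA.eq]
  refine ⟨G - Vᵀ * A⁻¹ * V, fromBlocks 1 (A⁻¹ * V) 0 1, fromBlocks 1 (- (A⁻¹ * V)) 0 1, ?_, ?_, ?_⟩
  · simp [fromBlocks_multiply]
  · simp [fromBlocks_multiply]
  · have e1 : A * (A⁻¹ * V) = V := by rw [← Matrix.mul_assoc, mul_nonsing_inv _ hu, Matrix.one_mul]
    have e2 : Vᵀ * A⁻¹ * A = Vᵀ := by rw [Matrix.mul_assoc, nonsing_inv_mul _ hu, Matrix.mul_one]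
    simp [bl, fromBlocks_multiply, fromBlocks_transpose, hinv, e1, e2, Matrix.mul_assoc]

theorem SD.of_R {A : Matrix ι ι ℤ} (h : R 1 A) : SD A := by
  induction h with
  | @empty ι _ _ _ A =>
    refine ⟨0, 0, ![], ![], fun i => i.elim0, fun i => i.elim0, 0, 0, ?_, ?_, ?_⟩ <;>
    · ext i; exact isEmptyElim i
  | ext A V G hA h0 h1 ih =>
    obtain ⟨a, b, D, D', hD, hD', hc⟩ := ih
    obtain ⟨g1, g2, g3⟩ := hA.good le_rfl
    obtain ⟨G', hG'⟩ := bl_unimod A g1 (by have := abs_pos.2 g2; omega) V G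
    have hG1 : G' = diagonal (fun _ => G' 0 0) := by
      ext i j; fin_cases i; fin_cases j; rfl
    have hu : PM (fun _ : Fin 1 => G' 0 0) := by
      intro _
      have := hG'.absdet
      rw [det_fromBlocks_zero₂₁, det_fin_one, abs_mul] at this
      have h2 := abs_pos.2 g2
      have h3 := abs_pos.2 h0
      have h4 : |A.det| = 1 := by omega
      rw [h4, one_mul] at this
      have h5 : |G' 0 0| = 1 := by omega
      exact Int.isUnit_iff.1 (Int.isUnit_iff_abs_eq.2 h5)
    rw [hG1] at hG'
    refine SD.mk' D (Sum.elim D' (fun _ : Fin 1 => G' 0 0)) hD ?_ ?_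
    · rintro (i | i)
      · exact hD' i
      · exact hu i
    · rw [← fromBlocks_diagonal]
      refine (hG'.sum (Cong.refl _)).trans ((sum_assoc _ _ _).trans ?_)
      refine ((Cong.refl A).sum (sum_comm' _ _)).trans ?_
      exact (sum_assoc _ _ _).symm.trans (hc.sum (Cong.refl _))
  | cong A B hA hAB ih =>
    obtain ⟨a, b, D, D', hD, hD', hc⟩ := ih
    exact ⟨a, b, D, D', hD, hD', (hAB.symm.sum (Cong.refl _)).trans hc⟩
  | unstab A ε hε hA ih =>
    obtain ⟨a, b, D, D', hD, hD', hc⟩ := ih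
    refine SD.mk' (Sum.elim (fun _ : Fin 1 => ε) D) D' ?_ hD' ?_
    · rintro (i | i)
      · exact hε
      · exact hD i
    · rw [← fromBlocks_diagonal]
      refine (sum_assoc _ _ _).symm.trans ?_
      simpa [bl] using hc

theorem SD.unimod (A : Matrix ι ι ℤ) (hA : A.IsSymm) (h : |A.det| = 1) : SD A := by
  have hc := Cong.submatrix A (Fintype.equivFin ι).symm
  refine SD.of_R (R.cong _ _ (R.unimod _ (hA.submatrix _) ?_) hc.symm)
  rw [← hc.absdet]; exact h

end sd

section marks
variable {ι κ l : Type} [Fintype ι] [Fintype κ] [Fintype l] [DecidableEq ι] [DecidableEq κ]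
  [DecidableEq l] {H : Type} [AddCommGroup H]

def act {κ : Type} (P : Matrix κ ι ℤ) (γ : ι → H) : κ → H := fun i => ∑ j, P i j • γ j

theorem act_mul {m : Type} (P : Matrix m κ ℤ) (Q : Matrix κ ι ℤ) (γ : ι → H) :
    act (P * Q) γ = act P (act Q γ) := by
  ext i
  simp only [act, Matrix.mul_apply, Finset.sum_smul, Finset.smul_sum, smul_smul]
  exact Finset.sum_comm

theorem act_one (γ : ι → H) : act (1 : Matrix ι ι ℤ) γ = γ := by
  ext i; simp [act, Matrix.one_apply]

theorem act_zero {m : Type} (P : Matrix m ι ℤ) : act P (0 : ι → H) = 0 := by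
  ext i; simp [act]

theorem zero_act {m : Type} (γ : ι → H) : act (0 : Matrix m ι ℤ) γ = 0 := by
  ext i; simp [act]

theorem act_sub {m : Type} (P Q : Matrix m ι ℤ) (γ : ι → H) :
    act (P - Q) γ = act P γ - act Q γ := by
  ext i; simp [act, sub_smul]

theorem act_cols {m : Type} (P : Matrix m ι ℤ) (Q : Matrix m κ ℤ) (γ : ι → H) (η : κ → H) :
    act (fromCols P Q) (Sum.elim γ η) = act P γ + act Q η := by
  ext i; simp [act]

theorem act_rows {m n : Type} (P : Matrix m ι ℤ) (Q : Matrix n ι ℤ) (γ : ι → H) :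
    act (fromRows P Q) γ = Sum.elim (act P γ) (act Q γ) := by
  ext i; rcases i with i | i <;> simp [act]

theorem act_blocks {m n : Type} (A : Matrix m ι ℤ) (B : Matrix m κ ℤ) (C : Matrix n ι ℤ)
    (D : Matrix n κ ℤ) (γ : ι → H) (η : κ → H) :
    act (fromBlocks A B C D) (Sum.elim γ η) =
      Sum.elim (act A γ + act B η) (act C γ + act D η) := by
  ext i; rcases i with i | i <;> simp [act]

def Iso (A : Matrix ι ι ℤ) (γ : ι → H) (B : Matrix κ κ ℤ) (η : κ → H) : Prop :=
  ∃ (P : Matrix κ ι ℤ) (Q : Matrix ι κ ℤ), Q * P = 1 ∧ P * Q = 1 ∧ A = Pᵀ * B * P ∧ act P γ = η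

theorem Iso.symm {A : Matrix ι ι ℤ} {B : Matrix κ κ ℤ} {γ : ι → H} {η : κ → H}
    (h : Iso A γ B η) : Iso B η A γ := by
  obtain ⟨P, Q, h1, h2, rfl, rfl⟩ := h
  refine ⟨Q, P, h2, h1, ?_, ?_⟩
  · have : Qᵀ * (Pᵀ * B * P) * Q = (P * Q)ᵀ * B * (P * Q) := by
      simp only [transpose_mul, Matrix.mul_assoc]
    rw [this, h2]; simp
  · rw [← act_mul, h1, act_one]

theorem Iso.trans {A : Matrix ι ι ℤ} {B : Matrix κ κ ℤ} {C : Matrix l l ℤ} {γ : ι → H} {η : κ → H}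
    {ζ : l → H} (h : Iso A γ B η) (h' : Iso B η C ζ) : Iso A γ C ζ := by
  obtain ⟨P, Q, h1, h2, rfl, rfl⟩ := h
  obtain ⟨P', Q', h1', h2', rfl, rfl⟩ := h'
  refine ⟨P' * P, Q * Q', ?_, ?_, ?_, ?_⟩
  · rw [Matrix.mul_assoc, ← Matrix.mul_assoc Q', h1', Matrix.one_mul, h1]
  · rw [Matrix.mul_assoc, ← Matrix.mul_assoc P, h2, Matrix.one_mul, h2']
  · simp only [transpose_mul, Matrix.mul_assoc]
  · rw [act_mul]

theorem Iso.refl (A : Matrix ι ι ℤ) (γ : ι → H) : Iso A γ A γ :=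
  ⟨1, 1, by simp, by simp, by simp, act_one γ⟩

theorem Iso.of_submatrix {A : Matrix ι ι ℤ} {B : Matrix κ κ ℤ} {γ : ι → H} {η : κ → H} (e : κ ≃ ι)
    (h : A.submatrix e e = B) (h' : ∀ i, γ (e i) = η i) : Iso A γ B η := by
  subst h
  refine ⟨(1 : Matrix ι ι ℤ).submatrix e id, (1 : Matrix ι ι ℤ).submatrix id e, ?_, ?_, ?_, ?_⟩
  · rw [Matrix.submatrix_mul_equiv]; simp
  · rw [← Matrix.submatrix_mul _ _ e id e Function.bijective_id]; simp
  · rw [Matrix.transpose_submatrix, Matrix.transpose_one, Matrix.submatrix_mul_equiv,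
      Matrix.submatrix_mul_equiv]; simp
  · ext i; rw [← h']; simp [act, Matrix.one_apply]

theorem Iso.sum {ι' κ' : Type} [Fintype ι'] [Fintype κ'] [DecidableEq ι'] [DecidableEq κ']
    {A : Matrix ι ι ℤ} {B : Matrix κ κ ℤ} {A' : Matrix ι' ι' ℤ} {B' : Matrix κ' κ' ℤ}
    {γ : ι → H} {η : κ → H} (h : Iso A γ B η) (h' : Cong A' B') :
    Iso (fromBlocks A 0 0 A') (Sum.elim γ 0) (fromBlocks B 0 0 B') (Sum.elim η 0) := by
  obtain ⟨P, Q, h1, h2, rfl, rfl⟩ := h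
  obtain ⟨P', Q', h1', h2', rfl⟩ := h'
  refine ⟨fromBlocks P 0 0 P', fromBlocks Q 0 0 Q', ?_, ?_, ?_, ?_⟩
  · simp [fromBlocks_multiply, *]
  · simp [fromBlocks_multiply, *]
  · simp [fromBlocks_multiply, fromBlocks_transpose]
  · rw [act_blocks, act_zero, act_zero, zero_act]; simp

theorem Iso.assoc (A : Matrix ι ι ℤ) (B : Matrix κ κ ℤ) (E : Matrix l l ℤ) (γ : ι → H) :
    Iso (fromBlocks (fromBlocks A 0 0 B) 0 0 E) (Sum.elim (Sum.elim γ 0) 0)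
      (fromBlocks A 0 0 (fromBlocks B 0 0 E)) (Sum.elim γ 0) := by
  refine Iso.of_submatrix (Equiv.sumAssoc _ _ _).symm ?_ ?_
  · ext i j
    rcases i with i | i | i <;> rcases j with j | j | j <;> simp [Equiv.sumAssoc]
  · rintro (i | i | i) <;> simp [Equiv.sumAssoc]

/-- presentation of the relations -/
def Ker (A : Matrix ι ι ℤ) (γ : ι → H) : Prop :=
  ∀ (n : ℕ) (M : Matrix (Fin n) ι ℤ), act M γ = 0 → ∃ N : Matrix (Fin n) ι ℤ, M = N * A

theorem exists_ker (X : Matrix κ ι ℤ) (J : Matrix ι κ ℤ) (h : X * J = 1) :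
    ∃ (n : ℕ) (K : Matrix ι (Fin n) ℤ) (S : Matrix (Fin n) ι ℤ), X * K = 0 ∧ S * J = 0 ∧
      S * K = 1 ∧ J * X + K * S = 1 := by
  let M := LinearMap.ker X.mulVecLin
  let b := Module.finBasis ℤ M
  let K : Matrix ι (Fin (Module.finrank ℤ M)) ℤ := of fun i j => (b j : ι → ℤ) i
  have hinj : ∀ v, K *ᵥ v = 0 → v = 0 := by
    intro v hv
    have h1 : ∑ j, v j • b j = 0 := by
      ext i
      have := congrFun hv i
      simpa [Matrix.mulVec, dotProduct, K, mul_comm] using this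
    funext j
    exact (Fintype.linearIndependent_iff.1 b.linearIndependent) v h1 j
  have hinj' : ∀ {m : Type} (N N' : Matrix (Fin (Module.finrank ℤ M)) m ℤ), K * N = K * N' → N = N' := by
    intro m N N' hN
    ext i j
    have h2 := hinj ((N - N').col j) (by
      funext k
      have : (K * (N - N')) k j = 0 := by rw [Matrix.mul_sub, hN, sub_self]; rfl
      simpa [Matrix.mulVec, dotProduct, Matrix.mul_apply] using this)
    have := congrFun h2 i
    simpa [sub_eq_zero] using this
  have hXK : X * K = 0 := by
    ext i j
    have h1 : X *ᵥ (b j : ι → ℤ) = 0 := (b j).2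
    have := congrFun h1 i
    simpa [Matrix.mulVec, dotProduct, K, Matrix.mul_apply] using this
  have hmem : ∀ i, (1 - J * X).col i ∈ M := by
    intro i
    change X *ᵥ _ = 0
    funext k
    have : (X * ((1 : Matrix ι ι ℤ) - J * X)) k i = 0 := by
      rw [Matrix.mul_sub, ← Matrix.mul_assoc, h]; simp
    simpa [Matrix.mulVec, dotProduct, Matrix.mul_apply] using this
  let S : Matrix (Fin (Module.finrank ℤ M)) ι ℤ := of fun j i => b.repr ⟨_, hmem i⟩ j
  have hKS : K * S = 1 - J * X := by
    ext k i
    have h1 := congrArg (fun x : M => (x : ι → ℤ) k) (b.sum_repr ⟨_, hmem i⟩)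
    simp only [Submodule.coe_sum, Finset.sum_apply] at h1
    simpa [Matrix.mul_apply, K, S, mul_comm] using h1
  refine ⟨_, K, S, hXK, ?_, ?_, ?_⟩
  · apply hinj'
    rw [← Matrix.mul_assoc, hKS, Matrix.sub_mul, Matrix.mul_assoc, h]; simp
  · apply hinj'
    rw [← Matrix.mul_assoc, hKS, Matrix.sub_mul, Matrix.mul_assoc, hXK]; simp
  · rw [hKS]; simp

theorem split (A : Matrix ι ι ℤ) (hA : A.IsSymm) (γ : ι → H) (hγ : Ker A γ)
    (B : Matrix κ κ ℤ) (η : κ → H) (hη : act B η = 0) (X : Matrix κ ι ℤ) (J : Matrix ι κ ℤ)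
    (hXJ : X * J = 1) (hAJ : A * J = Xᵀ * B) (hX : act X γ = η)
    (Y : Matrix ι κ ℤ) (hY : act Y η = γ) :
    ∃ (n : ℕ) (U : Matrix (Fin n) (Fin n) ℤ), U.IsSymm ∧ |U.det| = 1 ∧
      Iso A γ (fromBlocks B 0 0 U) (Sum.elim η 0) := by
  obtain ⟨n, K, S, hXK, hSJ, hSK, hone⟩ := exists_ker X J hXJ
  have hPQ : fromRows X S * fromCols J K = 1 := by
    rw [fromRows_mul_fromCols, hXJ, hXK, hSJ, hSK, fromBlocks_one]
  have hQP : fromCols J K * fromRows X S = 1 := by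
    rw [fromCols_mul_fromRows, hone]
  have e1 : Jᵀ * A = B.transpose * X := by
    have := congrArg transpose hAJ
    simpa [hA.eq] using this
  have hB : Jᵀ * (A * J) = B := by
    rw [hAJ, ← Matrix.mul_assoc, ← transpose_mul, hXJ]; simp
  have hKJ : Kᵀ * (A * J) = 0 := by
    rw [hAJ, ← Matrix.mul_assoc, ← transpose_mul, hXK]; simp
  have hJK : Jᵀ * (A * K) = 0 := by
    rw [← Matrix.mul_assoc, e1, Matrix.mul_assoc, hXK]; simp
  have hQAQ : (fromCols J K)ᵀ * A * fromCols J K = fromBlocks B 0 0 (Kᵀ * (A * K)) := by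
    rw [transpose_fromCols, Matrix.mul_assoc, mul_fromCols, fromRows_mul_fromCols, hB, hKJ, hJK]
  have hA' : A = (fromRows X S)ᵀ * fromBlocks B 0 0 (Kᵀ * (A * K)) * fromRows X S := by
    rw [← hQAQ]
    have : (fromRows X S)ᵀ * ((fromCols J K)ᵀ * A * fromCols J K) * fromRows X S =
      (fromCols J K * fromRows X S)ᵀ * A * (fromCols J K * fromRows X S) := by
      simp only [transpose_mul, Matrix.mul_assoc]
    rw [this, hQP]; simp
  set U := Kᵀ * (A * K) with hU
  obtain ⟨N, hN⟩ := hγ n (fromCols (-(S * Y)) (1 : Matrix (Fin n) (Fin n) ℤ) * fromRows X S) (by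
    rw [act_mul, act_rows, act_cols, hX, act_one]
    have : act (-(S * Y)) η = - act (S * Y) η := by
      have := act_sub 0 (S * Y) η
      rwa [zero_sub, zero_act, zero_sub] at this
    rw [this, act_mul, hY]; simp)
  have hM : fromCols (-(S * Y)) (1 : Matrix (Fin n) (Fin n) ℤ) = N * (fromRows X S)ᵀ * fromBlocks B 0 0 U := by
    have := congrArg (· * fromCols J K) hN
    simp only [Matrix.mul_assoc] at this
    rw [hPQ, Matrix.mul_one] at this
    rw [this]
    have h2 : A * fromCols J K = (fromRows X S)ᵀ * fromBlocks B 0 0 U := by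
      conv_lhs => rw [hA']
      rw [Matrix.mul_assoc, hPQ, Matrix.mul_one]
    rw [h2, Matrix.mul_assoc]
  rw [transpose_fromRows, mul_fromCols, fromCols_mul_fromBlocks] at hM
  obtain ⟨m1, m2⟩ := fromCols_inj hM
  simp only [Matrix.mul_zero, add_zero, zero_add] at m1 m2
  have hS : act S γ = 0 := by
    have h3 : S * Y = 0 - N * Xᵀ * B := by rw [← m1]; simp
    rw [← hY, ← act_mul, h3, act_sub, zero_act, act_mul, hη, act_zero, sub_zero]
  refine ⟨n, U, ?_, ?_, fromRows X S, fromCols J K, hQP, hPQ, hA', ?_⟩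
  · unfold Matrix.IsSymm; rw [hU]; simp only [transpose_mul, transpose_transpose, hA.eq, Matrix.mul_assoc]
  · have := congrArg det m2
    rw [det_one, det_mul] at this
    exact Int.isUnit_iff_abs_eq.1 (IsUnit.of_mul_eq_one_right _ this.symm)
  · rw [act_rows, hX, hS]

end marks

section tors
variable {ι : Type} [Fintype ι] [DecidableEq ι] {H : Type} [AddCommGroup H]

theorem tors1 {k : ℕ} (A : Matrix ι ι ℤ) (hA : A.IsSymm) (hA0 : A.det ≠ 0) (γ : ι → H)
    (hγ : Ker A γ) (B : Matrix (Fin k) (Fin k) ℤ) (hB : B.IsSymm) (hB0 : B.det ≠ 0)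
    (η : Fin k → H) (hη : act B η = 0) (X : Matrix (Fin k) ι ℤ) (hX : act X γ = η)
    (Y : Matrix ι (Fin k) ℤ) (hY : act Y η = γ) (E : Matrix (Fin k) (Fin k) ℤ)
    (hE : cq E = cq X * (cq A)⁻¹ * (cq X)ᵀ - (cq B)⁻¹) :
    ∃ (W : Matrix (Fin k ⊕ Fin k) (Fin k ⊕ Fin k) ℤ) (n : ℕ) (U : Matrix (Fin n) (Fin n) ℤ),
      W.IsSymm ∧ |W.det| = 1 ∧ U.IsSymm ∧ |U.det| = 1 ∧
      Iso (fromBlocks A 0 0 W) (Sum.elim γ 0) (fromBlocks B 0 0 U) (Sum.elim η 0) := by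
  have hAq : (cq A)ᵀ = cq A := by rw [← cq_transpose, hA.eq]
  have hBq : (cq B)ᵀ = cq B := by rw [← cq_transpose, hB.eq]
  have hEs : Eᵀ = E := by
    apply cq_inj
    rw [cq_transpose, hE]
    simp only [transpose_sub, transpose_mul, transpose_transpose, transpose_nonsing_inv, hAq, hBq,
      Matrix.mul_assoc]
  obtain ⟨Xt, hXt⟩ := hγ k (B * X) (by rw [act_mul, hX, hη])
  have hXt' : A * Xtᵀ = Xᵀ * B := by
    have := congrArg transpose hXt
    rw [transpose_mul, transpose_mul, hA.eq, hB.eq] at this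
    exact this.symm
  have hXX : X * Xtᵀ = E * B + 1 := by
    apply cq_inj
    rw [cq_add, cq_mul, cq_mul, hE, Matrix.sub_mul, nonsing_inv_mul _ (cq_isUnit hB0), cq_one]
    have h1 : cq A * cq Xtᵀ = (cq X)ᵀ * cq B := by
      rw [← cq_mul, hXt', cq_mul, cq_transpose]
    rw [Matrix.mul_assoc _ _ (cq B), ← h1, Matrix.mul_assoc, ← Matrix.mul_assoc _ (cq A),
      nonsing_inv_mul _ (cq_isUnit hA0)]
    simp
  let W : Matrix (Fin k ⊕ Fin k) (Fin k ⊕ Fin k) ℤ := fromBlocks 0 1 1 E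
  let W' : Matrix (Fin k ⊕ Fin k) (Fin k ⊕ Fin k) ℤ := fromBlocks (-E) 1 1 0
  have hWs : W.IsSymm := by
    unfold Matrix.IsSymm; simp [W, fromBlocks_transpose, hEs]
  have hWW : W' * W = 1 := by
    simp [W, W', fromBlocks_multiply]
  have hWd : |W.det| = 1 := by
    have := congrArg det hWW
    rw [det_one, det_mul] at this
    exact Int.isUnit_iff_abs_eq.1 (IsUnit.of_mul_eq_one_right _ this)
  have hAs : (fromBlocks A 0 0 W).IsSymm := by
    unfold Matrix.IsSymm; simp [fromBlocks_transpose, hA.eq, hWs.eq]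
  have hker : Ker (fromBlocks A 0 0 W) (Sum.elim γ 0 : ι ⊕ (Fin k ⊕ Fin k) → H) := by
    intro n M hM
    rw [← fromCols_toCols M] at hM ⊢
    rw [act_cols, act_zero, add_zero] at hM
    obtain ⟨N, hN⟩ := hγ n _ hM
    refine ⟨fromCols N (M.toCols₂ * W'), ?_⟩
    rw [fromCols_mul_fromBlocks, Matrix.mul_assoc _ W' W, hWW, ← hN]; simp
  obtain ⟨n, U, hU, hUd, hiso⟩ := split (fromBlocks A 0 0 W) hAs (Sum.elim γ 0) hker B η hη
    (fromCols X (fromCols 1 0)) (fromRows Xtᵀ (fromRows (-(E * B)) B))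
    (by rw [fromCols_mul_fromRows, fromCols_mul_fromRows, hXX]; simp)
    (by
      rw [fromBlocks_mul_fromRows, transpose_fromCols, transpose_fromCols, fromRows_mul,
        fromRows_mul, fromBlocks_mul_fromRows, hXt']
      simp)
    (by rw [act_cols, act_zero, add_zero, hX])
    (fromRows Y 0) (by rw [act_rows, hY, zero_act])
  exact ⟨W, n, U, hWs, hWd, hU, hUd, hiso⟩

theorem tors {k : ℕ} (A : Matrix ι ι ℤ) (hA : A.IsSymm) (hA0 : A.det ≠ 0) (γ : ι → H)
    (hγ : Ker A γ) (B : Matrix (Fin k) (Fin k) ℤ) (hB : B.IsSymm) (hB0 : B.det ≠ 0)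
    (η : Fin k → H) (hη : act B η = 0) (X : Matrix (Fin k) ι ℤ) (hX : act X γ = η)
    (Y : Matrix ι (Fin k) ℤ) (hY : act Y η = γ) (E : Matrix (Fin k) (Fin k) ℤ)
    (hE : cq E = cq X * (cq A)⁻¹ * (cq X)ᵀ - (cq B)⁻¹) :
    ∃ (a b : ℕ) (D : Fin a → ℤ) (D' : Fin b → ℤ), 0 < b ∧ PM D ∧ PM D' ∧
      Iso (fromBlocks A 0 0 (diagonal D)) (Sum.elim γ 0)
        (fromBlocks B 0 0 (diagonal D')) (Sum.elim η 0) := by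
  obtain ⟨W, n, U, hWs, hWd, hU, hUd, hiso⟩ := tors1 A hA hA0 γ hγ B hB hB0 η hη X hX Y hY E hE
  obtain ⟨a1, b1, D1, D1', p1, p1', c1⟩ := SD.unimod W hWs hWd
  obtain ⟨a2, b2, D2, D2', p2, p2', c2⟩ := SD.unimod U hU hUd
  let o : Fin 1 → ℤ := fun _ => 1
  have po : PM o := fun _ => Or.inl rfl
  let F := Sum.elim (Sum.elim D1' D2) o
  let F' := Sum.elim (Sum.elim D2' D1) o
  have hF : PM F := by rintro ((i | i) | i); exacts [p1' i, p2 i, po i]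
  have hF' : PM F' := by rintro ((i | i) | i); exacts [p2' i, p1 i, po i]
  have key : Iso (fromBlocks A 0 0 (diagonal F)) (Sum.elim γ 0)
        (fromBlocks B 0 0 (diagonal F')) (Sum.elim η 0) := by
    simp only [F, F', ← fromBlocks_diagonal]
    have l1 : Cong (fromBlocks (diagonal D1') 0 0 (diagonal D2))
      (fromBlocks W 0 0 (fromBlocks (diagonal D1) 0 0 (diagonal D2))) :=
      (c1.symm.sum (Cong.refl _)).trans (sum_assoc _ _ _)
    have l2 : Cong (fromBlocks U 0 0 (fromBlocks (diagonal D1) 0 0 (diagonal D2)))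
      (fromBlocks (diagonal D2') 0 0 (diagonal D1)) :=
      (((Cong.refl U).sum (sum_comm' _ _)).trans (sum_assoc _ _ _).symm).trans
        (c2.sum (Cong.refl _))
    have l3 := (Iso.assoc A (fromBlocks (diagonal D1') 0 0 (diagonal D2)) (diagonal o) γ).symm
    refine l3.trans (Iso.trans (Iso.sum ?_ (Cong.refl _))
      (Iso.assoc B (fromBlocks (diagonal D2') 0 0 (diagonal D1)) (diagonal o) η))
    refine (Iso.sum (Iso.refl A γ) l1).trans ?_
    refine (Iso.assoc _ _ _ _).symm.trans ?_
    refine (Iso.sum hiso (Cong.refl _)).trans ?_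
    exact (Iso.assoc _ _ _ _).trans (Iso.sum (Iso.refl B η) l2)
  refine ⟨_, _, F ∘ (Fintype.equivFin _).symm, F' ∘ (Fintype.equivFin _).symm, ?_, fun i => hF _,
    fun i => hF' _, ?_⟩
  · simp
  · have h1 : Cong (diagonal F) (diagonal (F ∘ (Fintype.equivFin _).symm)) :=
      Cong.of_submatrix (Fintype.equivFin _).symm (by rw [submatrix_diagonal_equiv])
    have h2 : Cong (diagonal F') (diagonal (F' ∘ (Fintype.equivFin _).symm)) :=
      Cong.of_submatrix (Fintype.equivFin _).symm (by rw [submatrix_diagonal_equiv])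
    exact (Iso.sum (Iso.refl A γ) h1.symm).trans (key.trans (Iso.sum (Iso.refl B η) h2))

end tors

section fin
variable {H : Type} [AddCommGroup H]

def eN (a r s : ℕ) : Fin (a + (r + s)) ≃ Fin a ⊕ (Fin r ⊕ Fin s) :=
  finSumFinEquiv.symm.trans (Equiv.sumCongr (Equiv.refl _) finSumFinEquiv.symm)

theorem mat_eN {a r s : ℕ} (D : Matrix (Fin a) (Fin a) ℤ)
    (A : Matrix (Fin r ⊕ Fin s) (Fin r ⊕ Fin s) ℤ) :
    reindex finSumFinEquiv finSumFinEquiv (fromBlocks D 0 0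
      (reindex finSumFinEquiv finSumFinEquiv A)) =
    (fromBlocks D 0 0 A).submatrix (eN a r s) (eN a r s) := by
  ext i j
  obtain ⟨i, rfl⟩ := finSumFinEquiv.surjective i
  obtain ⟨j, rfl⟩ := finSumFinEquiv.surjective j
  rcases i with i | i <;> rcases j with j | j <;>
    simp only [reindex_apply, submatrix_apply, eN, Equiv.trans_apply, Equiv.symm_apply_apply,
      Equiv.sumCongr_apply, Sum.map_inl, Sum.map_inr, fromBlocks_apply₁₁, fromBlocks_apply₁₂,
      fromBlocks_apply₂₁, fromBlocks_apply₂₂, Equiv.refl_apply, Matrix.zero_apply]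

theorem mark_eN {a r s : ℕ} (γ : Fin r ⊕ Fin s → H) (i) :
    Fin.append (fun _ : Fin a => (0 : H)) (γ ∘ finSumFinEquiv.symm) i =
      Sum.elim (0 : Fin a → H) γ (eN a r s i) := by
  obtain ⟨i, rfl⟩ := finSumFinEquiv.surjective i
  rcases i with i | i <;> simp [eN]

theorem flip_sign {b : ℕ} {κ : Type} [Fintype κ] [DecidableEq κ] (hb : 0 < b) (D : Fin b → ℤ)
    (B : Matrix κ κ ℤ) (η : κ → H) :
    ∃ S : Matrix (Fin b ⊕ κ) (Fin b ⊕ κ) ℤ, S.det = -1 ∧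
      Sᵀ * fromBlocks (diagonal D) 0 0 B * S = fromBlocks (diagonal D) 0 0 B ∧
      act S (Sum.elim (0 : Fin b → H) η) = Sum.elim (0 : Fin b → H) η := by
  let d : Fin b → ℤ := fun i => if i = ⟨0, hb⟩ then -1 else 1
  have hd : ∀ i, d i * d i = 1 := fun i => by by_cases h : i = ⟨0, hb⟩ <;> simp [d, h]
  refine ⟨fromBlocks (diagonal d) 0 0 1, ?_, ?_, ?_⟩
  · rw [det_fromBlocks_zero₂₁, det_one, mul_one, det_diagonal]
    simp only [d]
    rw [Finset.prod_ite_eq' ]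
    simp
  · rw [fromBlocks_transpose, fromBlocks_multiply, fromBlocks_multiply]
    simp
    intro i
    rw [mul_right_comm, hd, one_mul]
  · rw [act_blocks, act_zero, act_zero, act_one, zero_act]; simp

theorem finish {r s r' s' a b : ℕ} (D : Fin a → ℤ) (D' : Fin b → ℤ) (hb : 0 < b) (hD : PM D)
    (hD' : PM D') (A : Matrix (Fin r ⊕ Fin s) (Fin r ⊕ Fin s) ℤ) (γ : Fin r ⊕ Fin s → H)
    (B : Matrix (Fin r' ⊕ Fin s') (Fin r' ⊕ Fin s') ℤ) (η : Fin r' ⊕ Fin s' → H)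
    (h : Iso (fromBlocks (diagonal D) 0 0 A) (Sum.elim (0 : Fin a → H) γ) (fromBlocks (diagonal D') 0 0 B)
      (Sum.elim (0 : Fin b → H) η)) :
    ∃ (p q : ℕ) (hN : p + (r + s) = q + (r' + s'))
      (DA : Fin p → ℤ) (DB : Fin q → ℤ)
      (P : Matrix (Fin (p + (r + s))) (Fin (p + (r + s))) ℤ),
      (∀ i, DA i = 1 ∨ DA i = -1) ∧ (∀ i, DB i = 1 ∨ DB i = -1) ∧
      P.det = 1 ∧
      Matrix.reindex finSumFinEquiv finSumFinEquiv
          (Matrix.fromBlocks (Matrix.diagonal DA) 0 0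
            (Matrix.reindex finSumFinEquiv finSumFinEquiv A)) =
        Pᵀ * (Matrix.reindex (finCongr hN).symm (finCongr hN).symm
          (Matrix.reindex finSumFinEquiv finSumFinEquiv
            (Matrix.fromBlocks (Matrix.diagonal DB) 0 0
              (Matrix.reindex finSumFinEquiv finSumFinEquiv B)))) * P ∧
      (∀ i, ∑ j, P i j •
          Fin.append (fun _ => (0 : H)) (γ ∘ finSumFinEquiv.symm) j =
        Fin.append (fun _ => (0 : H)) (η ∘ finSumFinEquiv.symm)
          (finCongr hN i)) := by
  obtain ⟨P, Q, hQP, hPQ, hA, hm⟩ := h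
  have hN : a + (r + s) = b + (r' + s') := by
    have := Matrix.square_of_invertible Q P hQP hPQ
    simpa using this
  let e := eN a r s
  let f : Fin (a + (r + s)) ≃ Fin b ⊕ (Fin r' ⊕ Fin s') := (finCongr hN).trans (eN b r' s')
  obtain ⟨P, hd, hA, hm⟩ : ∃ P : Matrix (Fin b ⊕ (Fin r' ⊕ Fin s')) (Fin a ⊕ (Fin r ⊕ Fin s)) ℤ,
      (P.submatrix f e).det = 1 ∧
      fromBlocks (diagonal D) 0 0 A = Pᵀ * fromBlocks (diagonal D') 0 0 B * P ∧
      act P (Sum.elim (0 : Fin a → H) γ) = Sum.elim (0 : Fin b → H) η := by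
    have hu : (P.submatrix f e) * (Q.submatrix e f) = 1 := by
      rw [submatrix_mul_equiv, hPQ]; simp
    have hu' := congrArg det hu
    rw [det_mul, det_one] at hu'
    rcases Int.isUnit_iff.1 (IsUnit.of_mul_eq_one _ hu') with h1 | h1
    · exact ⟨P, h1, hA, hm⟩
    · obtain ⟨S, s1, s2, s3⟩ := flip_sign hb D' B η
      refine ⟨S * P, ?_, ?_, ?_⟩
      · have : (S * P).submatrix f e = S.submatrix f f * P.submatrix f e := by
          rw [submatrix_mul_equiv]
        rw [this, det_mul, h1, det_submatrix_equiv_self, s1]; rfl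
      · rw [hA, transpose_mul]
        conv_lhs => rw [← s2]
        simp only [Matrix.mul_assoc]
      · rw [act_mul, hm, s3]
  refine ⟨a, b, hN, D, D', P.submatrix f e, hD, hD', hd, ?_, ?_⟩
  · rw [mat_eN, mat_eN]
    have : reindex (finCongr hN).symm (finCongr hN).symm
      ((fromBlocks (diagonal D') 0 0 B).submatrix (eN b r' s') (eN b r' s')) =
      (fromBlocks (diagonal D') 0 0 B).submatrix f f := rfl
    rw [this, transpose_submatrix, submatrix_mul_equiv, submatrix_mul_equiv, ← hA]
  · intro i
    rw [mark_eN]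
    simp only [mark_eN]
    have h1 := congrFun hm (f i)
    rw [act, ← Equiv.sum_comp e] at h1
    exact h1

theorem add_free {r s r' s' a b : ℕ} (D : Fin a → ℤ) (D' : Fin b → ℤ)
    (A : Matrix (Fin r) (Fin r) ℤ) (γ : Fin r → H)
    (B : Matrix (Fin r') (Fin r') ℤ) (η : Fin r' → H)
    (h : Iso (fromBlocks A 0 0 (diagonal D)) (Sum.elim γ (0 : Fin a → H))
        (fromBlocks B 0 0 (diagonal D')) (Sum.elim η (0 : Fin b → H)))
    (γf : Fin s → H) (ηf : Fin s' → H) (W : Matrix (Fin s') (Fin r) ℤ)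
    (Z : Matrix (Fin s') (Fin s) ℤ) (Z' : Matrix (Fin s) (Fin s') ℤ) (hZ : Z' * Z = 1)
    (hZ' : Z * Z' = 1) (hW : act W γ + act Z γf = ηf) :
    Iso (fromBlocks (diagonal D) 0 0 (fromBlocks A 0 0 (0 : Matrix (Fin s) (Fin s) ℤ))) (Sum.elim (0 : Fin a → H) (Sum.elim γ γf))
      (fromBlocks (diagonal D') 0 0 (fromBlocks B 0 0 (0 : Matrix (Fin s') (Fin s') ℤ))) (Sum.elim (0 : Fin b → H) (Sum.elim η ηf)) := by
  obtain ⟨P, Q, hQP, hPQ, hA, hm⟩ := h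
  have key : Iso (fromBlocks (fromBlocks A 0 0 (diagonal D)) 0 0 (0 : Matrix (Fin s) (Fin s) ℤ))
      (Sum.elim (Sum.elim γ (0 : Fin a → H)) γf)
      (fromBlocks (fromBlocks B 0 0 (diagonal D')) 0 0 (0 : Matrix (Fin s') (Fin s') ℤ))
      (Sum.elim (Sum.elim η (0 : Fin b → H)) ηf) := by
    refine ⟨fromBlocks P 0 (fromCols W (0 : Matrix (Fin s') (Fin a) ℤ)) Z, fromBlocks Q 0 (-(Z' * fromCols W (0 : Matrix (Fin s') (Fin a) ℤ) * Q)) Z', ?_, ?_,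
      ?_, ?_⟩
    · generalize fromCols W (0 : Matrix (Fin s') (Fin a) ℤ) = V
      have e1 : -(Z' * V * Q) * P = -(Z' * V) := by
        rw [Matrix.neg_mul, Matrix.mul_assoc, hQP, Matrix.mul_one]
      rw [fromBlocks_multiply, hQP, e1, hZ]; simp
    · generalize fromCols W (0 : Matrix (Fin s') (Fin a) ℤ) = V
      have e1 : Z * -(Z' * V * Q) = -(V * Q) := by
        rw [Matrix.mul_neg, ← Matrix.mul_assoc, ← Matrix.mul_assoc, hZ', Matrix.one_mul]
      rw [fromBlocks_multiply, hPQ, e1, hZ']; simp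
    · rw [fromBlocks_transpose, fromBlocks_multiply, fromBlocks_multiply, hA]; simp
    · rw [act_blocks, hm, act_cols, zero_act, act_zero, add_zero, add_zero, hW]
  let g : ∀ a r s : ℕ, Fin a ⊕ (Fin r ⊕ Fin s) ≃ (Fin r ⊕ Fin a) ⊕ Fin s := fun a r s =>
    (Equiv.sumAssoc _ _ _).symm.trans (Equiv.sumCongr (Equiv.sumComm _ _) (Equiv.refl _))
  refine (Iso.of_submatrix (g a r s) ?_ ?_).symm.trans (key.trans
    (Iso.of_submatrix (g b r' s') ?_ ?_))
  · ext i j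
    rcases i with i | i | i <;> rcases j with j | j | j <;> simp [g, Equiv.sumAssoc]
  · rintro (i | i | i) <;> simp [g, Equiv.sumAssoc]
  · ext i j
    rcases i with i | i | i <;> rcases j with j | j | j <;> simp [g, Equiv.sumAssoc]
  · rintro (i | i | i) <;> simp [g, Equiv.sumAssoc]

end fin

section pres
variable {H : Type} [AddCommGroup H]

theorem act_surj {ι κ : Type} [Fintype ι] [Fintype κ] (γ : ι → H)
    (h : Function.Surjective fun v : ι → ℤ => ∑ i, v i • γ i) (η : κ → H) :
    ∃ X : Matrix κ ι ℤ, act X γ = η := by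
  choose X hX using fun k => h (η k)
  exact ⟨X, funext hX⟩

theorem ker_mat {r s : ℕ} {κ : Type} (A₀ : Matrix (Fin r) (Fin r) ℤ) (hs : A₀.IsSymm)
    (γ : Fin r ⊕ Fin s → H)
    (hγker : ∀ v : Fin r ⊕ Fin s → ℤ, (∑ i, v i • γ i) = 0 ↔
      ∃ w : Fin r ⊕ Fin s → ℤ, v = Matrix.fromBlocks A₀ 0 0 0 *ᵥ w)
    (M : Matrix κ (Fin r ⊕ Fin s) ℤ) (hM : act M γ = 0) :
    (∀ k j, M k (Sum.inr j) = 0) ∧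
      ∃ N : Matrix κ (Fin r) ℤ, ∀ k j, M k (Sum.inl j) = (N * A₀) k j := by
  choose w hw using fun k => (hγker (M k)).1 (congrFun hM k)
  refine ⟨fun k j => ?_, fun k i => w k (Sum.inl i), fun k j => ?_⟩
  · rw [hw k]; simp [mulVec, dotProduct, Fintype.sum_sum_type]
  · rw [hw k]
    simp only [mulVec, dotProduct, Fintype.sum_sum_type, fromBlocks_apply₁₁, fromBlocks_apply₁₂,
      Matrix.zero_apply, zero_mul, Finset.sum_const_zero, add_zero, Matrix.mul_apply]
    refine Finset.sum_congr rfl fun i _ => ?_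
    rw [mul_comm, hs.apply]

theorem ker_A {r s : ℕ} (A₀ : Matrix (Fin r) (Fin r) ℤ) (hs : A₀.IsSymm)
    (γ : Fin r ⊕ Fin s → H)
    (hγker : ∀ v : Fin r ⊕ Fin s → ℤ, (∑ i, v i • γ i) = 0 ↔
      ∃ w : Fin r ⊕ Fin s → ℤ, v = Matrix.fromBlocks A₀ 0 0 0 *ᵥ w) :
    act A₀ (γ ∘ Sum.inl) = 0 := by
  funext i
  have h := (hγker (Sum.elim (A₀ i) 0)).2 ⟨Pi.single (Sum.inl i) 1, by
    funext j
    rcases j with j | j <;> simp [hs.apply]⟩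
  simpa [act, Fintype.sum_sum_type] using h

theorem ker_Ker {r s : ℕ} (A₀ : Matrix (Fin r) (Fin r) ℤ) (hs : A₀.IsSymm)
    (γ : Fin r ⊕ Fin s → H)
    (hγker : ∀ v : Fin r ⊕ Fin s → ℤ, (∑ i, v i • γ i) = 0 ↔
      ∃ w : Fin r ⊕ Fin s → ℤ, v = Matrix.fromBlocks A₀ 0 0 0 *ᵥ w) :
    Ker A₀ (γ ∘ Sum.inl) := by
  intro n M hM
  obtain ⟨-, N, hN⟩ := ker_mat A₀ hs γ hγker (fun k => Sum.elim (M k) 0) (by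
    funext k
    have := congrFun hM k
    simpa [act, Fintype.sum_sum_type] using this)
  exact ⟨N, by ext k j; exact hN k j⟩

theorem tor_block {r s : ℕ} {κ : Type} (A₀ : Matrix (Fin r) (Fin r) ℤ) (hs : A₀.IsSymm)
    (γ : Fin r ⊕ Fin s → H)
    (hγker : ∀ v : Fin r ⊕ Fin s → ℤ, (∑ i, v i • γ i) = 0 ↔
      ∃ w : Fin r ⊕ Fin s → ℤ, v = Matrix.fromBlocks A₀ 0 0 0 *ᵥ w)
    (X : Matrix κ (Fin r ⊕ Fin s) ℤ) (k : κ) (hk : act X γ k ∈ Submodule.torsion ℤ H)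
    (j : Fin s) : X k (Sum.inr j) = 0 := by
  obtain ⟨⟨a, ha⟩, h⟩ := (Submodule.mem_torsion_iff _).1 hk
  have ha0 : a ≠ 0 := nonZeroDivisors.ne_zero ha
  have h' : a • act X γ k = 0 := h
  obtain ⟨h1, -⟩ := ker_mat A₀ hs γ hγker (κ := Unit) (fun _ i => a * X k i) (by
    funext _
    simpa [act, Finset.smul_sum, mul_smul] using h')
  exact (mul_eq_zero.1 (h1 () j)).resolve_left ha0

theorem free_inv {r s r' s' : ℕ} (A₀ : Matrix (Fin r) (Fin r) ℤ) (hs : A₀.IsSymm)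
    (γ : Fin r ⊕ Fin s → H)
    (hγker : ∀ v : Fin r ⊕ Fin s → ℤ, (∑ i, v i • γ i) = 0 ↔
      ∃ w : Fin r ⊕ Fin s → ℤ, v = Matrix.fromBlocks A₀ 0 0 0 *ᵥ w)
    (η : Fin r' ⊕ Fin s' → H)
    (X : Matrix (Fin r' ⊕ Fin s') (Fin r ⊕ Fin s) ℤ) (hX : act X γ = η)
    (Y : Matrix (Fin r ⊕ Fin s) (Fin r' ⊕ Fin s') ℤ) (hY : act Y η = γ)
    (h12 : ∀ i j, X (Sum.inl i) (Sum.inr j) = 0) :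
    Y.toBlocks₂₂ * X.toBlocks₂₂ = 1 := by
  obtain ⟨h1, -⟩ := ker_mat A₀ hs γ hγker (Y * X - 1) (by
    rw [act_sub, act_mul, hX, hY, act_one, sub_self])
  ext i j
  have h := h1 (Sum.inr i) j
  rw [Matrix.sub_apply, sub_eq_zero, Matrix.mul_apply, Fintype.sum_sum_type] at h
  simp only [h12, mul_zero, Finset.sum_const_zero, zero_add] at h
  rw [Matrix.mul_apply]
  simp only [toBlocks₂₂, of_apply]
  rw [h]
  simp [Matrix.one_apply]

theorem phi_sum (φ : Submodule.torsion ℤ H → Submodule.torsion ℤ H → QZ)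
    (hφadd : ∀ x y z, φ (x + y) z = φ x z + φ y z)
    (hφadd' : ∀ x y z, φ x (y + z) = φ x y + φ x z) {r : ℕ}
    (g : Fin r → Submodule.torsion ℤ H) (u v : Fin r → ℤ) :
    φ (∑ i, u i • g i) (∑ j, v j • g j) = ∑ i, ∑ j, (u i * v j) • φ (g i) (g j) := by
  have h1 : ∀ z, φ (∑ i, u i • g i) z = ∑ i, u i • φ (g i) z := fun z => by
    have := map_sum (AddMonoidHom.mk' (fun x => φ x z) (fun x y => hφadd x y z))
      (fun i => u i • g i) Finset.univ
    simp only [map_zsmul] at this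
    exact this
  have h2 : ∀ x, φ x (∑ i, v i • g i) = ∑ i, v i • φ x (g i) := fun x => by
    have := map_sum (AddMonoidHom.mk' (fun y => φ x y) (fun y z => hφadd' x y z))
      (fun i => v i • g i) Finset.univ
    simp only [map_zsmul] at this
    exact this
  rw [h1]
  refine Finset.sum_congr rfl fun i _ => ?_
  rw [h2, Finset.smul_sum]
  exact Finset.sum_congr rfl fun j _ => by rw [mul_smul]

theorem get_E (φ : Submodule.torsion ℤ H → Submodule.torsion ℤ H → QZ)
    (hφadd : ∀ x y z, φ (x + y) z = φ x z + φ y z)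
    (hφadd' : ∀ x y z, φ x (y + z) = φ x y + φ x z) {r r' : ℕ}
    (A : Matrix (Fin r) (Fin r) ℚ) (B : Matrix (Fin r') (Fin r') ℚ)
    (γ : Fin r → H) (hγ : ∀ i, γ i ∈ Submodule.torsion ℤ H)
    (hA : ∀ i j, φ ⟨γ i, hγ i⟩ ⟨γ j, hγ j⟩ = ((A i j : ℚ) : QZ))
    (η : Fin r' → H) (hη : ∀ i, η i ∈ Submodule.torsion ℤ H)
    (hB : ∀ i j, φ ⟨η i, hη i⟩ ⟨η j, hη j⟩ = ((B i j : ℚ) : QZ))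
    (X : Matrix (Fin r') (Fin r) ℤ) (hX : act X γ = η) :
    ∃ E : Matrix (Fin r') (Fin r') ℤ, cq E = cq X * A * (cq X)ᵀ - B := by
  have hx : ∀ i, (⟨η i, hη i⟩ : Submodule.torsion ℤ H) = ∑ k, X i k • ⟨γ k, hγ k⟩ := by
    intro i
    apply Subtype.ext
    have := congrFun hX i
    simp [act] at this
    simp [this]
  have key : ∀ i j, ∃ e : ℤ, (e : ℚ) = (cq X * A * (cq X)ᵀ - B) i j := by
    intro i j
    have h := hB i j
    rw [hx i, hx j, phi_sum φ hφadd hφadd'] at h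
    simp only [hA] at h
    have h3 : (((cq X * A * (cq X)ᵀ - B) i j : ℚ) : QZ) = 0 := by
      rw [Matrix.sub_apply, AddCircle.coe_sub, ← h, sub_eq_zero]
      have : (cq X * A * (cq X)ᵀ) i j = ∑ k, ∑ l, (X i k * X j l) • A k l := by
        simp only [Matrix.mul_apply, Matrix.transpose_apply, cq_apply, Finset.sum_mul]
        rw [Finset.sum_comm]
        refine Finset.sum_congr rfl fun k _ => Finset.sum_congr rfl fun l _ => ?_
        simp; ring
      rw [this]
      have hs : ∀ f : ℚ, (f : QZ) = QuotientAddGroup.mk' (AddSubgroup.zmultiples (1 : ℚ)) f :=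
        fun _ => rfl
      simp only [hs, map_sum, map_zsmul]
    obtain ⟨n, hn⟩ := (AddCircle.coe_eq_zero_iff (1 : ℚ)).1 h3
    exact ⟨n, by simpa using hn⟩
  choose E hE using key
  exact ⟨E, by ext i j; exact hE i j⟩

end pres

end StabCong

/-- let `(H, φ)` be a linked group (finitely generated abelian group
with a linking pairing `φ` on its torsion subgroup), `A = diag(A₀, 0)` an admissible
linking matrix (indexed by `Fin r ⊕ Fin s`) with an `A`-presentation `γ` of `H`, and
`B = diag(B₀, 0)` an admissible linking matrix (indexed by `Fin r' ⊕ Fin s'`) with a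
`B`-presentation `η` of `H`. Then there are stabilizations `Ã = diag(D_A, A)` and
`B̃ = diag(D_B, B)` of equal size `N = p + (r+s) = q + (r'+s')` and a unimodular
matrix `P` with `Ã = Pᵀ B̃ P` and `P·(0,…,0,γ) = (0,…,0,η)` in `H^N`. -/
theorem stabilized_congruence_of_admissible_presentations {r s r' s' : ℕ}
    (H : Type) [AddCommGroup H] [Module.Finite ℤ H]
    (φ : Submodule.torsion ℤ H → Submodule.torsion ℤ H → QZ)
    (hφsymm : ∀ x y, φ x y = φ y x)
    (hφadd : ∀ x y z, φ (x + y) z = φ x z + φ y z)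
    (hφadd' : ∀ x y z, φ x (y + z) = φ x y + φ x z)
    (A₀ : Matrix (Fin r) (Fin r) ℤ) (hA₀sym : A₀.IsSymm) (hA₀det : A₀.det ≠ 0)
    (B₀ : Matrix (Fin r') (Fin r') ℤ) (hB₀sym : B₀.IsSymm) (hB₀det : B₀.det ≠ 0)
    (γ : Fin r ⊕ Fin s → H)
    (hγsurj : Function.Surjective fun v : Fin r ⊕ Fin s → ℤ => ∑ i, v i • γ i)
    (hγker : ∀ v : Fin r ⊕ Fin s → ℤ, (∑ i, v i • γ i) = 0 ↔
      ∃ w : Fin r ⊕ Fin s → ℤ, v = Matrix.fromBlocks A₀ 0 0 0 *ᵥ w)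
    (hγtor : ∀ i : Fin r, γ (Sum.inl i) ∈ Submodule.torsion ℤ H)
    (hφγ : ∀ i j : Fin r, φ ⟨γ (Sum.inl i), hγtor i⟩ ⟨γ (Sum.inl j), hγtor j⟩ =
      (((mQ A₀)⁻¹ i j : ℚ) : QZ))
    (η : Fin r' ⊕ Fin s' → H)
    (hηsurj : Function.Surjective fun v : Fin r' ⊕ Fin s' → ℤ => ∑ i, v i • η i)
    (hηker : ∀ v : Fin r' ⊕ Fin s' → ℤ, (∑ i, v i • η i) = 0 ↔
      ∃ w : Fin r' ⊕ Fin s' → ℤ, v = Matrix.fromBlocks B₀ 0 0 0 *ᵥ w)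
    (hηtor : ∀ i : Fin r', η (Sum.inl i) ∈ Submodule.torsion ℤ H)
    (hφη : ∀ i j : Fin r', φ ⟨η (Sum.inl i), hηtor i⟩ ⟨η (Sum.inl j), hηtor j⟩ =
      (((mQ B₀)⁻¹ i j : ℚ) : QZ)) :
    ∃ (p q : ℕ) (hN : p + (r + s) = q + (r' + s'))
      (DA : Fin p → ℤ) (DB : Fin q → ℤ)
      (P : Matrix (Fin (p + (r + s))) (Fin (p + (r + s))) ℤ),
      (∀ i, DA i = 1 ∨ DA i = -1) ∧ (∀ i, DB i = 1 ∨ DB i = -1) ∧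
      P.det = 1 ∧
      Matrix.reindex finSumFinEquiv finSumFinEquiv
          (Matrix.fromBlocks (Matrix.diagonal DA) 0 0
            (Matrix.reindex finSumFinEquiv finSumFinEquiv
              (Matrix.fromBlocks A₀ 0 0 0))) =
        Pᵀ * (Matrix.reindex (finCongr hN).symm (finCongr hN).symm
          (Matrix.reindex finSumFinEquiv finSumFinEquiv
            (Matrix.fromBlocks (Matrix.diagonal DB) 0 0
              (Matrix.reindex finSumFinEquiv finSumFinEquiv
                (Matrix.fromBlocks B₀ 0 0 0))))) * P ∧
      (∀ i, ∑ j, P i j •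
          Fin.append (fun _ => (0 : H)) (γ ∘ finSumFinEquiv.symm) j =
        Fin.append (fun _ => (0 : H)) (η ∘ finSumFinEquiv.symm)
          (finCongr hN i)) := by
  obtain ⟨X0, hX0⟩ := StabCong.act_surj γ hγsurj η
  obtain ⟨Y0, hY0⟩ := StabCong.act_surj η hηsurj γ
  have hX12 : ∀ i j, X0 (Sum.inl i) (Sum.inr j) = 0 := fun i j =>
    StabCong.tor_block A₀ hA₀sym γ hγker X0 (Sum.inl i) (by rw [hX0]; exact hηtor i) j
  have hY12 : ∀ i j, Y0 (Sum.inl i) (Sum.inr j) = 0 := fun i j =>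
    StabCong.tor_block B₀ hB₀sym η hηker Y0 (Sum.inl i) (by rw [hY0]; exact hγtor i) j
  have hZ := StabCong.free_inv A₀ hA₀sym γ hγker η X0 hX0 Y0 hY0 hX12
  have hZ' := StabCong.free_inv B₀ hB₀sym η hηker γ Y0 hY0 X0 hX0 hY12
  have hX : StabCong.act X0.toBlocks₁₁ (γ ∘ Sum.inl) = η ∘ Sum.inl := by
    funext i
    have h := congrFun hX0 (Sum.inl i)
    simpa [StabCong.act, Fintype.sum_sum_type, hX12, toBlocks₁₁] using h
  have hY : StabCong.act Y0.toBlocks₁₁ (η ∘ Sum.inl) = γ ∘ Sum.inl := by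
    funext i
    have h := congrFun hY0 (Sum.inl i)
    simpa [StabCong.act, Fintype.sum_sum_type, hY12, toBlocks₁₁] using h
  have hW : StabCong.act X0.toBlocks₂₁ (γ ∘ Sum.inl) + StabCong.act X0.toBlocks₂₂ (γ ∘ Sum.inr) =
      η ∘ Sum.inr := by
    funext i
    have h := congrFun hX0 (Sum.inr i)
    simpa [StabCong.act, Fintype.sum_sum_type, toBlocks₂₁, toBlocks₂₂] using h
  obtain ⟨E, hE⟩ := StabCong.get_E φ hφadd hφadd' _ _ (γ ∘ Sum.inl) hγtor hφγ (η ∘ Sum.inl) hηtor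
    hφη X0.toBlocks₁₁ hX
  obtain ⟨a, b, D, D', hb, hD, hD', hI⟩ := StabCong.tors A₀ hA₀sym hA₀det (γ ∘ Sum.inl)
    (StabCong.ker_Ker A₀ hA₀sym γ hγker) B₀ hB₀sym hB₀det (η ∘ Sum.inl)
    (StabCong.ker_A B₀ hB₀sym η hηker) X0.toBlocks₁₁ hX Y0.toBlocks₁₁ hY E hE
  have hF := StabCong.add_free D D' A₀ (γ ∘ Sum.inl) B₀ (η ∘ Sum.inl) hI (γ ∘ Sum.inr)
    (η ∘ Sum.inr) X0.toBlocks₂₁ X0.toBlocks₂₂ Y0.toBlocks₂₂ hZ hZ' hW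
  rw [Sum.elim_comp_inl_inr, Sum.elim_comp_inl_inr] at hF
  exact StabCong.finish D D' hb hD hD' _ γ _ η hF
end
end
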